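/- Let A be a Q-projective resolution of R = Q/I with A_0 = Q equipped with an A∞-algebra structure, and let G be a Q-projective resolution of an R-module M. Then there exists an A∞ A-module structure on G: a sequence of degree −1 maps m_n^G : (A_{≥1}[1])^{⊗(n−1)} ⊗ G → G with m_1^G = d^G, m_1^G m_2^G + m_2^G(m_1⊗1 + 1⊗m_1^G) = d_1^A ⊗ 1, and the module Stasheff relations for n ≥ 3. -/

import Mathlib

open scoped DirectSum TensorProduct
open Function LinearMap

namespace Golod

structure Cx (Q : Type) [CommRing Q] : Type 1 where
  X : ℕ → Type
  [acg : ∀ i, AddCommGroup (X i)]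
  [mod : ∀ i, Module Q (X i)]
  d : ∀ i, X (i + 1) →ₗ[Q] X i

attribute [instance] Cx.acg Cx.mod

variable {Q : Type} [CommRing Q]

/-- The positive part `A_{≥1}`, reindexed so that index `i` holds `A_{i+1}`. -/
abbrev Cx.plus (C : Cx Q) : Type := ⨁ i : ℕ, C.X (i + 1)

/-- The total module of a complex. -/
abbrev Cx.total (C : Cx Q) : Type := ⨁ i : ℕ, C.X i

def Cx.incl (C : Cx Q) (i : ℕ) : C.X (i + 1) →ₗ[Q] C.plus :=
  DirectSum.lof Q ℕ (fun j => C.X (j + 1)) i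

def Cx.inclT (C : Cx Q) (i : ℕ) : C.X i →ₗ[Q] C.total :=
  DirectSum.lof Q ℕ (fun j => C.X j) i

def Cx.IsComplex (C : Cx Q) : Prop := ∀ i, (C.d i).comp (C.d (i + 1)) = 0

def Cx.IsRes (C : Cx Q) (M : Type) [AddCommGroup M] [Module Q M]
    (ε : C.X 0 →ₗ[Q] M) : Prop :=
  C.IsComplex ∧ Surjective ε ∧ range (C.d 0) = ker ε ∧
    ∀ i, range (C.d (i + 1)) = ker (C.d i)

def Cx.IsProjRes (C : Cx Q) (M : Type) [AddCommGroup M] [Module Q M]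
    (ε : C.X 0 →ₗ[Q] M) : Prop :=
  C.IsRes M ε ∧ ∀ i, Module.Projective Q (C.X i)

/-- Minimality of a complex over a local ring with maximal ideal `𝔫`. -/
def Cx.Min (C : Cx Q) (𝔫 : Ideal Q) : Prop :=
  ∀ i x, C.d i x ∈ 𝔫 • (⊤ : Submodule Q (C.X i))

/-- The curvature term `d_1^A : A_1 → A_0 = Q`, viewed on all of `A_{≥1}`. -/
def Cx.d1 (C : Cx Q) (e0 : C.X 0 ≃ₗ[Q] Q) : ∀ i, C.X (i + 1) → Q
  | 0, x => e0 (C.d 0 x)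
  | _ + 1, _ => 0

/-- The data of a family of multilinear "higher multiplication" maps on `A_{≥1}[1]`. -/
def AAlgStr (C : Cx Q) : Type :=
  ∀ n : ℕ, MultilinearMap Q (fun _ : Fin n => C.plus) C.plus

/-- The data of a family of multilinear "higher action" maps, `mG k` corresponding to
`m_{k+1}^G : (A_{≥1}[1])^{⊗ k} ⊗ G → G`. -/
def AModStr (C : Cx Q) (G : Cx Q) : Type :=
  ∀ k : ℕ, MultilinearMap Q (fun _ : Fin k => C.plus) (G.total →ₗ[Q] G.total)

/-- The curved Stasheff relations making `(m_n)` an A∞-algebra structure on a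
`Q`-projective resolution `A` of `R = Q/I` with `A_0 = Q` (via `e0`). -/
def IsAInfAlg (C : Cx Q) (e0 : C.X 0 ≃ₗ[Q] Q) (m : AAlgStr C) : Prop :=
  -- each `m_n` has degree `-1` on `A_{≥1}[1]`
  (∀ n : ℕ, 0 < n → ∀ (a : ℕ → ℕ) (x : ∀ l, C.X (a l + 1)),
      m n (fun j : Fin n => C.incl (a j) (x j)) ∈
        Set.range (C.incl ((∑ l ∈ Finset.range n, a l) + 2 * n - 3)))
  -- `m_1 = d^{A[1]}` restricted to `A_{≥1}[1]`
  ∧ (∀ (i : ℕ) (x : C.X (i + 2)), m 1 (fun _ => C.incl (i + 1) x) = - C.incl i (C.d (i + 1) x))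
  ∧ (∀ x : C.X 1, m 1 (fun _ => C.incl 0 x) = 0)
  -- the curved relation `m₁m₂ + m₂(m₁⊗1 + 1⊗m₁) = d₁ ⊗ 1 - 1 ⊗ d₁`
  ∧ (∀ (a : ℕ → ℕ) (x : ∀ l, C.X (a l + 1)),
      m 1 (fun _ => m 2 ![C.incl (a 0) (x 0), C.incl (a 1) (x 1)])
        + m 2 ![m 1 (fun _ => C.incl (a 0) (x 0)), C.incl (a 1) (x 1)]
        + ((-1 : ℤ) ^ (a 0)) • m 2 ![C.incl (a 0) (x 0), m 1 (fun _ => C.incl (a 1) (x 1))]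
      = C.d1 e0 (a 0) (x 0) • C.incl (a 1) (x 1)
        - C.d1 e0 (a 1) (x 1) • C.incl (a 0) (x 0))
  -- the Stasheff relations for `n ≥ 3`
  ∧ (∀ n : ℕ, 3 ≤ n → ∀ (a : ℕ → ℕ) (x : ∀ l, C.X (a l + 1)),
      (∑ i ∈ Finset.Icc 1 n, ∑ j ∈ Finset.range (n - i + 1),
        ((-1 : ℤ) ^ (∑ l ∈ Finset.range j, a l)) •
          m (n - i + 1) (fun k : Fin (n - i + 1) =>
            if (k : ℕ) < j then C.incl (a k) (x k)
            else if (k : ℕ) = j then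
              m i (fun l : Fin i => C.incl (a (j + (l : ℕ))) (x (j + (l : ℕ))))
            else C.incl (a ((k : ℕ) + i - 1)) (x ((k : ℕ) + i - 1)))) = 0)

/-- The curved Stasheff relations making `(m_n^G)` an A∞ `A`-module structure on a
`Q`-projective resolution `G` of the `R`-module `M`; `mG k` is `m_{k+1}^G`. -/
def IsAInfMod (C : Cx Q) (e0 : C.X 0 ≃ₗ[Q] Q) (m : AAlgStr C) (G : Cx Q)
    (mG : AModStr C G) : Prop :=
  -- degree `-1`
  (∀ (k : ℕ) (a : ℕ → ℕ) (x : ∀ l, C.X (a l + 1)) (g : ℕ) (y : G.X g),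
      mG k (fun j : Fin k => C.incl (a j) (x j)) (G.inclT g y) ∈
        Set.range (G.inclT ((∑ l ∈ Finset.range k, a l) + 2 * k + g - 1)))
  -- `m_1^G = d^G`
  ∧ (∀ (i : ℕ) (y : G.X (i + 1)), mG 0 ![] (G.inclT (i + 1) y) = G.inclT i (G.d i y))
  ∧ (∀ y : G.X 0, mG 0 ![] (G.inclT 0 y) = 0)
  -- `m₁^G m₂^G + m₂^G(m₁ ⊗ 1 + 1 ⊗ m₁^G) = d₁^A ⊗ 1`
  ∧ (∀ (a : ℕ → ℕ) (x : ∀ l, C.X (a l + 1)) (g : ℕ) (y : G.X g),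
      mG 0 ![] (mG 1 ![C.incl (a 0) (x 0)] (G.inclT g y))
        + mG 1 ![m 1 (fun _ => C.incl (a 0) (x 0))] (G.inclT g y)
        + ((-1 : ℤ) ^ (a 0)) • mG 1 ![C.incl (a 0) (x 0)] (mG 0 ![] (G.inclT g y))
      = C.d1 e0 (a 0) (x 0) • G.inclT g y)
  -- the module Stasheff relations for `n ≥ 3`
  ∧ (∀ n : ℕ, 3 ≤ n → ∀ (a : ℕ → ℕ) (x : ∀ l, C.X (a l + 1)) (g : ℕ) (y : G.X g),
      (∑ i ∈ Finset.Icc 1 n,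
        ((∑ j ∈ Finset.range (n - i),
          ((-1 : ℤ) ^ (∑ l ∈ Finset.range j, a l)) •
            mG (n - i) (fun k : Fin (n - i) =>
              if (k : ℕ) < j then C.incl (a k) (x k)
              else if (k : ℕ) = j then
                m i (fun l : Fin i => C.incl (a (j + (l : ℕ))) (x (j + (l : ℕ))))
              else C.incl (a ((k : ℕ) + i - 1)) (x ((k : ℕ) + i - 1)))
              (G.inclT g y))
          + ((-1 : ℤ) ^ (∑ l ∈ Finset.range (n - i), a l)) •
            mG (n - i) (fun k : Fin (n - i) => C.incl (a k) (x k))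
              ((mG (i - 1) (fun l : Fin (i - 1) =>
                  C.incl (a (n - i + (l : ℕ))) (x (n - i + (l : ℕ)))))
                (G.inclT g y)))) = 0)

/-- Minimality of an A∞-algebra structure: `m_n ⊗ k = 0` for all `n ≥ 2`. -/
def AAlgStr.Min {C : Cx Q} (m : AAlgStr C) (𝔫 : Ideal Q) : Prop :=
  ∀ n, 2 ≤ n → ∀ v, m n v ∈ 𝔫 • (⊤ : Submodule Q C.plus)

/-- Minimality of an A∞-module structure: `m_n^G ⊗ k = 0` for all `n ≥ 2`. -/
def AModStr.Min {C G : Cx Q} (mG : AModStr C G) (𝔫 : Ideal Q) : Prop :=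
  ∀ k, 1 ≤ k → ∀ v y, mG k v y ∈ 𝔫 • (⊤ : Submodule Q G.total)

end Golod

namespace Golod

section Words

variable {Q L V W : Type*} [CommRing Q] [AddCommGroup L] [Module Q L]
  [AddCommGroup V] [Module Q V] [AddCommGroup W] [Module Q W]

/-- The sum of `F u v` over all deconcatenations `w = u ++ v`. -/
def splitSum {α V : Type*} [AddCommGroup V] : (List α → List α → V) → List α → V
  | F, [] => F [] []
  | F, x :: w => F [] (x :: w) + splitSum (fun u v => F (x :: u) v) w

/-- Precomposition of a function `f` on words with the coderivation induced by `m`: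
the sum of `f (σ u ++ m v :: t)` over all `w = u ++ v ++ t` with `v` nonempty. -/
def bar {L V : Type*} [AddCommGroup V] (σ : L → L) (m : List L → L) :
    (List L → V) → List L → V
  | _, [] => 0
  | f, x :: w => bar σ m (fun w => f (σ x :: w)) w + splitSum (fun u v => f (m (x :: u) :: v)) w

/-- A function on words which is linear in each letter. -/
def WordLinear (Q : Type*) {L V : Type*} [CommRing Q] [AddCommGroup L] [Module Q L]
    [AddCommGroup V] [Module Q V] (f : List L → V) : Prop :=
  ∀ u v, IsLinearMap Q (fun x => f (u ++ x :: v))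

section SplitSum

variable {α β : Type*}

theorem splitSum_congr {F G : List α → List α → V} {w : List α}
    (h : ∀ u v, u ++ v = w → F u v = G u v) : splitSum F w = splitSum G w := by
  induction w generalizing F G with
  | nil => exact h _ _ rfl
  | cons x w ih =>
    simp only [splitSum]
    rw [h [] (x :: w) rfl, ih fun u v huv => h (x :: u) v (by simp [huv])]

theorem splitSum_mem (S : Submodule Q V) {F : List α → List α → V} {w : List α}
    (h : ∀ u v, u ++ v = w → F u v ∈ S) : splitSum F w ∈ S := by
  induction w generalizing F with
  | nil => exact h _ _ rfl
  | cons x w ih =>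
    exact S.add_mem (h [] (x :: w) rfl) (ih fun u v huv => h (x :: u) v (by simp [huv]))

theorem splitSum_eq_zero {F : List α → List α → V} {w : List α}
    (h : ∀ u v, u ++ v = w → F u v = 0) : splitSum F w = 0 := by
  simpa using splitSum_mem (⊥ : Submodule ℤ V) (by simpa using h)

theorem splitSum_add (F G : List α → List α → V) (w : List α) :
    splitSum (fun u v => F u v + G u v) w = splitSum F w + splitSum G w := by
  induction w generalizing F G with
  | nil => rfl
  | cons x w ih => simp only [splitSum, ih]; abel

theorem map_splitSum (φ : V →+ W) (F : List α → List α → V) (w : List α) :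
    φ (splitSum F w) = splitSum (fun u v => φ (F u v)) w := by
  induction w generalizing F with
  | nil => rfl
  | cons x w ih => simp only [splitSum, map_add, ih]

theorem splitSum_neg (F : List α → List α → V) (w : List α) :
    splitSum (fun u v => - F u v) w = - splitSum F w :=
  (map_splitSum (negAddMonoidHom (α := V)) F w).symm

theorem splitSum_smul (c : Q) (F : List α → List α → V) (w : List α) :
    splitSum (fun u v => c • F u v) w = c • splitSum F w :=
  (map_splitSum (DistribSMul.toAddMonoidHom V c) F w).symm

theorem splitSum_map (g : α → β) (F : List β → List β → V) (w : List α) :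
    splitSum F (w.map g) = splitSum (fun u v => F (u.map g) (v.map g)) w := by
  induction w generalizing F with
  | nil => rfl
  | cons x w ih => simp [splitSum, ih]

theorem splitSum_assoc (F : List α → List α → List α → V) (w : List α) :
    splitSum (fun u v => splitSum (fun s t => F u s t) v) w
      = splitSum (fun p t => splitSum (fun u s => F u s t) p) w := by
  induction w generalizing F with
  | nil => rfl
  | cons x w ih => simp only [splitSum, ih, splitSum_add]; abel

theorem splitSum_eq_sum (F : List α → List α → V) (w : List α) :
    splitSum F w = ∑ i ∈ Finset.range (w.length + 1), F (w.take i) (w.drop i) := by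
  induction w generalizing F with
  | nil => simp [splitSum]
  | cons x w ih =>
    rw [List.length_cons, Finset.sum_range_succ']
    simp [splitSum, ih, add_comm]

end SplitSum

namespace WordLinear

variable {f g : List L → V}

theorem cons (hf : WordLinear Q f) (x : L) : WordLinear Q (fun w => f (x :: w)) :=
  fun u v => hf (x :: u) v

theorem head (hf : WordLinear Q f) (w : List L) : IsLinearMap Q (fun x => f (x :: w)) :=
  hf [] w

theorem add (hf : WordLinear Q f) (hg : WordLinear Q g) :
    WordLinear Q (fun w => f w + g w) := fun u v =>
  ⟨fun x y => by simp only [(hf u v).map_add, (hg u v).map_add]; abel,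
   fun c x => by simp only [(hf u v).map_smul, (hg u v).map_smul, smul_add]⟩

theorem map (φ : V →ₗ[Q] W) (hf : WordLinear Q f) : WordLinear Q (fun w => φ (f w)) := fun u v =>
  ⟨fun x y => by simp only [(hf u v).map_add, _root_.map_add],
   fun c x => by simp only [(hf u v).map_smul, _root_.map_smul]⟩

theorem sub (hf : WordLinear Q f) (hg : WordLinear Q g) :
    WordLinear Q (fun w => f w - g w) := by
  simpa [sub_eq_add_neg] using hf.add (hg.map (-LinearMap.id))

theorem comp_map (σ : L →ₗ[Q] L) (hf : WordLinear Q f) :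
    WordLinear Q (fun w => f (w.map σ)) := fun u v =>
  ⟨fun x y => by simp [(hf _ _).map_add], fun c x => by simp [(hf _ _).map_smul]⟩

theorem eq_zero_of_mem (hf : WordLinear Q f) {w : List L} (h : (0 : L) ∈ w) : f w = 0 := by
  obtain ⟨u, v, rfl⟩ := List.append_of_mem h
  exact (hf u v).map_zero

theorem splitSum {F : List L → List L → V} (h₁ : ∀ v, WordLinear Q (fun u => F u v))
    (h₂ : ∀ u, WordLinear Q (F u)) : WordLinear Q (splitSum F) := by
  intro u
  induction u generalizing F with
  | nil =>
    intro v
    refine ⟨fun x y => ?_, fun c x => ?_⟩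
    · simp only [List.nil_append, Golod.splitSum, ((h₂ []).head v).map_add,
        fun u v => ((h₁ v).head u).map_add, splitSum_add]
      abel
    · simp only [List.nil_append, Golod.splitSum, ((h₂ []).head v).map_smul,
        fun u v => ((h₁ v).head u).map_smul, splitSum_smul, smul_add]
  | cons z u ih =>
    intro v
    have h := ih (F := fun u v => F (z :: u) v) (fun v => (h₁ v).cons z) (fun u => h₂ _) v
    have h' := h₂ [] (z :: u) v
    refine ⟨fun x y => ?_, fun c x => ?_⟩
    · have e := h'.map_add x y
      simp only [List.cons_append] at e
      simp only [List.cons_append, Golod.splitSum, h.map_add, e]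
      abel
    · have e := h'.map_smul c x
      simp only [List.cons_append] at e
      simp only [List.cons_append, Golod.splitSum, h.map_smul, e, smul_add]

end WordLinear

section Bar

variable {σ : L →ₗ[Q] L} {m : List L → L}

theorem bar_add {L : Type*} (σ : L → L) (m : List L → L) (f g : List L → V) (w : List L) :
    bar σ m (fun w => f w + g w) w = bar σ m f w + bar σ m g w := by
  induction w generalizing f g with
  | nil => simp [bar]
  | cons x w ih => simp only [bar, ih, splitSum_add]; abel

theorem map_bar {L : Type*} (σ : L → L) (m : List L → L) (φ : V →+ W) (f : List L → V)
    (w : List L) : φ (bar σ m f w) = bar σ m (fun w => φ (f w)) w := by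
  induction w generalizing f with
  | nil => simp [bar]
  | cons x w ih => simp only [bar, ih, map_add, map_splitSum]

theorem bar_neg {L : Type*} (σ : L → L) (m : List L → L) (f : List L → V) (w : List L) :
    bar σ m (fun w => - f w) w = - bar σ m f w :=
  (map_bar σ m (negAddMonoidHom (α := V)) f w).symm

theorem bar_smul {L : Type*} (σ : L → L) (m : List L → L) (c : Q) (f : List L → V)
    (w : List L) :
    bar σ m (fun w => c • f w) w = c • bar σ m f w :=
  (map_bar σ m (DistribSMul.toAddMonoidHom V c) f w).symm

theorem WordLinear.bar {f : List L → V} (hm : WordLinear Q m) (hf : WordLinear Q f) :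
    WordLinear Q (bar σ m f) := by
  intro u
  induction u generalizing f with
  | nil =>
    intro v
    refine ⟨fun x y => ?_, fun c x => ?_⟩
    · simp only [List.nil_append, Golod.bar, map_add, (hm.head _).map_add,
        (hf.head _).map_add, bar_add, splitSum_add]
      abel
    · simp only [List.nil_append, Golod.bar, map_smul, (hm.head _).map_smul,
        (hf.head _).map_smul, bar_smul, splitSum_smul, smul_add]
  | cons z u ih =>
    intro v
    have h₁ := ih (hf.cons (σ z)) v
    have h₂ := WordLinear.splitSum (F := fun u v => f (m (z :: u) :: v))
      (fun v => (hm.cons z).map ((hf.head v).mk')) (fun u => hf.cons _) u v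
    exact ⟨fun x y => by simp only [List.cons_append, Golod.bar, h₁.map_add, h₂.map_add]; abel,
      fun c x => by
        simp only [List.cons_append, Golod.bar, h₁.map_smul, h₂.map_smul, smul_add]⟩

/-- The co-Leibniz rule for the coderivation. -/
theorem bar_splitSum {L : Type*} (σ : L → L) (m : List L → L) (F : List L → List L → V)
    (w : List L) :
    bar σ m (splitSum F) w
      = splitSum (fun u v => bar σ m (fun u => F u v) u) w
        + splitSum (fun u v => bar σ m (F (u.map σ)) v) w := by
  induction w generalizing F with
  | nil => simp [bar, splitSum]
  | cons x w ih =>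
    simp only [bar, splitSum, bar_add, splitSum_add, ih, List.map_nil, List.map_cons,
      splitSum_assoc (fun u s t => F (m (x :: u) :: s) t)]
    abel

theorem bar_comp_map (hσ : ∀ x, σ (σ x) = x) (hσm : ∀ w, σ (m w) = - m (w.map σ))
    {f : List L → V} (hf : WordLinear Q f) (w : List L) :
    bar σ m (fun w => f (w.map σ)) w = - bar σ m f (w.map σ) := by
  induction w generalizing f with
  | nil => simp [bar]
  | cons x w ih =>
    simp only [bar, List.map_cons, hσ, hσm, (hf.head _).map_neg, splitSum_neg, splitSum_map,
      ih (hf.cons _)]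
    abel

/-- A linear form, extended by zero from one-letter words to all words. -/
def ofLetter {L V : Type*} [AddCommGroup V] (h : L → V) : List L → V
  | [x] => h x
  | _ => 0

theorem splitSum_ofLetter_smul {L : Type*} (h : L → Q) (f : List L → V) (x : L) (w : List L) :
    splitSum (fun u v => ofLetter h u • f v) (x :: w) = h x • f w := by
  cases w with
  | nil => simp [splitSum, ofLetter]
  | cons y w =>
    simp only [splitSum, ofLetter, zero_smul, zero_add]
    rw [splitSum_eq_zero, add_zero]
    exact fun _ _ _ => rfl

theorem bar_bar (hσ : ∀ x, σ (σ x) = x) (hσm : ∀ w, σ (m w) = - m (w.map σ))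
    (h : L →ₗ[Q] Q) (h₁ : ∀ x, bar σ m m [x] = 0)
    (h₂ : ∀ x y, bar σ m m [x, y] = h x • y - h y • x)
    (h₃ : ∀ x y z w, bar σ m m (x :: y :: z :: w) = 0)
    {f : List L → V} (hf : WordLinear Q f) (w : List L) :
    bar σ m (bar σ m f) w
      = splitSum (fun u v => ofLetter h u • f v) w
        - splitSum (fun u v => ofLetter h v • f u) w := by
  induction w generalizing f with
  | nil => simp [bar, splitSum, ofLetter]
  | cons x w ih =>
    have key : bar σ m (bar σ m f) (x :: w)
        = bar σ m (bar σ m fun w => f (x :: w)) w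
          + splitSum (fun u v => f (bar σ m m (x :: u) :: v)) w := by
      have e₁ : ∀ u v, f (bar σ m m (x :: u) :: v)
          = bar σ m (fun u => f (m (σ x :: u) :: v)) u
            + splitSum (fun s t => f (m (m (x :: s) :: t) :: v)) u := fun u v => by
        have a := map_bar σ m ((hf.head v).mk' (fun y => f (y :: v))).toAddMonoidHom
          (fun u => m (σ x :: u)) u
        have b := map_splitSum ((hf.head v).mk' (fun y => f (y :: v))).toAddMonoidHom
          (fun s t => m (m (x :: s) :: t)) u
        simp only [LinearMap.toAddMonoidHom_coe, IsLinearMap.mk'_apply] at a b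
        simp only [bar, (hf.head v).map_add, a, b]
      simp only [e₁, splitSum_add]
      simp only [bar, hσ, bar_add, bar_splitSum, hσm, (hf.head _).map_neg, bar_neg, splitSum_neg,
        splitSum_add, List.map_cons,
        splitSum_assoc (fun u s t => f (m (m (x :: u) :: s) :: t))]
      abel
    rw [key, ih (hf.cons x), splitSum_ofLetter_smul]
    cases w with
    | nil => simp [splitSum, ofLetter, h₁, (hf.head _).map_zero]
    | cons y w =>
      have e₂ : splitSum (fun u v => f (bar σ m m (x :: u) :: v)) (y :: w)
          = h x • f (y :: w) - h y • f (x :: w) := by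
        cases w with
        | nil => simp [splitSum, h₁, h₂, (hf.head _).map_zero, (hf.head _).map_sub,
            (hf.head _).map_smul]
        | cons z w =>
          simp only [splitSum, h₁, h₂, h₃, (hf.head _).map_zero, (hf.head _).map_sub,
            (hf.head _).map_smul]
          rw [splitSum_eq_zero fun _ _ _ => rfl]
          abel
      rw [e₂, splitSum_ofLetter_smul]
      simp only [splitSum, ofLetter, zero_smul]
      abel

theorem bar_eq_zero {L : Type*} (σ : L → L) (m : List L → L) {f : List L → V}
    (h : ∀ u v t, f (u ++ m v :: t) = 0) (w : List L) : bar σ m f w = 0 := by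
  induction w generalizing f with
  | nil => rfl
  | cons x w ih =>
    rw [bar, ih fun u v t => h (σ x :: u) v t, zero_add]
    exact splitSum_eq_zero fun u v _ => h [] _ v

theorem bar_ofLetter {L : Type*} (σ : L → L) (m : List L → L) {h : L → V}
    (hm : ∀ w, h (m w) = 0) (w : List L) : bar σ m (ofLetter h) w = 0 := by
  refine bar_eq_zero σ m (fun u v t => ?_) w
  match u, t with
  | [], [] => exact hm v
  | [], _ :: _ => rfl
  | [_], _ => rfl
  | _ :: _ :: _, _ => rfl

theorem ofLetter_map {V : Type*} [AddCommGroup V] {h : L → V} (hσ : ∀ x, h (σ x) = h x)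
    (w : List L) :
    ofLetter h (w.map σ) = ofLetter h w := by
  match w with
  | [] => rfl
  | [x] => exact hσ x
  | _ :: _ :: _ => rfl

end Bar

section Curvature

variable {T : Type*} [AddCommGroup T] [Module Q T] {σ : L →ₗ[Q] L} {m : List L → L}

/-- The defect of the module Stasheff relations for a family `μ` of higher actions. -/
def defect (σ : L →ₗ[Q] L) (m : List L → L) (h : L →ₗ[Q] Q)
    (μ : List L → Module.End Q T) (w : List L) : Module.End Q T :=
  bar σ m μ w + splitSum (fun u v => μ (u.map σ) * μ v) w - ofLetter h w • 1

theorem mul_splitSum {α : Type*} (a : Module.End Q T) (F : List α → List α → Module.End Q T)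
    (w : List α) : a * splitSum F w = splitSum (fun u v => a * F u v) w :=
  map_splitSum (AddMonoidHom.mulLeft a) F w

theorem splitSum_mul {α : Type*} (F : List α → List α → Module.End Q T) (a : Module.End Q T)
    (w : List α) : splitSum F w * a = splitSum (fun u v => F u v * a) w :=
  map_splitSum (AddMonoidHom.mulRight a) F w

/-- The Bianchi identity for the defect. -/
theorem bar_defect (hσ : ∀ x, σ (σ x) = x) (hσm : ∀ w, σ (m w) = - m (w.map σ))
    (h : L →ₗ[Q] Q) (h₁ : ∀ x, bar σ m m [x] = 0)
    (h₂ : ∀ x y, bar σ m m [x, y] = h x • y - h y • x)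
    (h₃ : ∀ x y z w, bar σ m m (x :: y :: z :: w) = 0)
    (hhσ : ∀ x, h (σ x) = h x) (hhm : ∀ w, h (m w) = 0)
    {μ : List L → Module.End Q T} (hμ : WordLinear Q μ) (w : List L) :
    bar σ m (defect σ m h μ) w
      = splitSum (fun u v => μ u * defect σ m h μ v) w
        - splitSum (fun u v => defect σ m h μ (u.map σ) * μ v) w := by
  have hσσ : ∀ u : List L, (u.map σ).map σ = u := fun u => by simp [Function.comp_def, hσ]
  have e₀ : bar σ m (fun w => -(ofLetter h w • (1 : Module.End Q T))) w = 0 := by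
    have := map_bar σ m ((LinearMap.toSpanSingleton Q (Module.End Q T) (-1)).toAddMonoidHom)
      (ofLetter h) w
    rw [bar_ofLetter σ m hhm, map_zero] at this
    simpa using this.symm
  have e₁ : ∀ u v, bar σ m (fun u => μ (u.map σ) * μ v) u = - (bar σ m μ (u.map σ) * μ v) :=
    fun u v => by
      rw [← neg_mul, ← bar_comp_map hσ hσm hμ]
      exact (map_bar σ m (AddMonoidHom.mulRight (μ v)) _ u).symm
  have e₂ : ∀ u v, bar σ m (fun v => μ u * μ v) v = μ u * bar σ m μ v := fun u v =>
    (map_bar σ m (AddMonoidHom.mulLeft (μ u)) _ v).symm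
  have lhs : bar σ m (defect σ m h μ) w
      = bar σ m (bar σ m μ) w + bar σ m (splitSum fun u v => μ (u.map σ) * μ v) w := by
    rw [← add_zero (_ + _), ← e₀, ← bar_add, ← bar_add]
    simp only [← sub_eq_add_neg]
    rfl
  rw [lhs, bar_bar hσ hσm h h₁ h₂ h₃ hμ, bar_splitSum]
  simp only [hσσ, e₁, e₂, defect, mul_add, add_mul, sub_eq_add_neg, splitSum_add,
    splitSum_neg, splitSum_map, mul_splitSum, splitSum_mul, ofLetter_map hhσ, mul_neg, neg_mul,
    mul_smul_comm, smul_mul_assoc, mul_one, one_mul]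
  have := splitSum_assoc (fun u s t => μ u * (μ (s.map σ) * μ t)) w
  simp only [mul_assoc, this]
  abel

end Curvature

end Words
end Golod

namespace Golod

section ListFn

variable {Q L V : Type*} [CommRing Q] [AddCommGroup L] [Module Q L]
  [AddCommGroup V] [Module Q V]

/-- A family of multilinear maps, seen as a function on words. -/
def listFn (f : ∀ k : ℕ, MultilinearMap Q (fun _ : Fin k => L) V) (w : List L) : V :=
  f w.length w.get

theorem listFn_eq (f : ∀ k : ℕ, MultilinearMap Q (fun _ : Fin k => L) V) {k : ℕ} {w : List L}
    (v : Fin k → L) (hw : w = List.ofFn v) : listFn f w = f k v := by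
  have key : ∀ n (hn : w.length = n), listFn f w = f n (fun i => w.get (i.cast hn.symm)) := by
    rintro n rfl
    rfl
  rw [key k (by simp [hw])]
  subst hw
  simp

theorem wordLinear_listFn (f : ∀ k : ℕ, MultilinearMap Q (fun _ : Fin k => L) V) :
    WordLinear Q (listFn f) := by
  intro u v
  have key : ∀ x, listFn f (u ++ x :: v) = f (u.length + (v.length + 1))
      (Function.update (fun i => (u ++ 0 :: v).get (i.cast (by simp)))
        ⟨u.length, by omega⟩ x) := by
    intro x
    refine listFn_eq f _ (List.ext_getElem (by simp [add_assoc]) fun i h₁ h₂ => ?_)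
    rw [List.getElem_ofFn, Function.update_apply]
    split_ifs with h
    · simp only [Fin.mk.injEq] at h
      subst h
      simp
    · simp only [Fin.mk.injEq] at h
      rcases lt_or_gt_of_ne h with h | h
      · simp [h]
      · obtain ⟨j, rfl⟩ := Nat.exists_eq_add_of_lt h
        simp [add_assoc]
  exact ⟨fun x y => by simp only [key, MultilinearMap.map_update_add],
    fun c x => by simp only [key, MultilinearMap.map_update_smul]⟩

/-- The restriction of a letterwise linear function to words of fixed length. -/
def WordLinear.toMultilinear {f : List L → V} (hf : WordLinear Q f) (k : ℕ) :
    MultilinearMap Q (fun _ : Fin k => L) V :=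
  have key : ∀ (v : Fin k → L) (i : Fin k) (x : L), List.ofFn (Function.update v i x)
      = (List.ofFn v).take i ++ x :: (List.ofFn v).drop (i + 1) := fun v i x => by
    have h := List.set_eq_take_append_cons_drop (l := List.ofFn v) (i := i) (a := x)
    rw [if_pos (by simp)] at h
    rw [← h]
    refine List.ext_getElem (by simp) fun j h₁ h₂ => ?_
    simp [List.getElem_set, Function.update_apply, Fin.ext_iff, eq_comm]
  MultilinearMap.mk' (fun v => f (List.ofFn v))
    (fun v i x y => by simp only [key, (hf _ _).map_add])
    (fun v i c x => by simp only [key, (hf _ _).map_smul])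

theorem bar_eq_sum {L : Type*} (σ : L → L) (m : List L → L) (f : List L → V) (w : List L) :
    bar σ m f w = ∑ i ∈ Finset.Icc 1 w.length, ∑ j ∈ Finset.range (w.length + 1 - i),
      f ((w.take j).map σ ++ m ((w.drop j).take i) :: w.drop (j + i)) := by
  induction w generalizing f with
  | nil => simp [bar]
  | cons x w ih =>
    have e₁ : ∀ i ∈ Finset.Icc 1 (w.length + 1),
        ∑ j ∈ Finset.range (w.length + 1 + 1 - i),
          f (((x :: w).take j).map σ ++ m (((x :: w).drop j).take i) :: (x :: w).drop (j + i))
        = ∑ j ∈ Finset.range (w.length + 1 - i),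
          f (σ x :: ((w.take j).map σ ++ m ((w.drop j).take i) :: w.drop (j + i)))
          + f (m ((x :: w).take i) :: (x :: w).drop i) := by
      intro i hi
      rw [Finset.mem_Icc] at hi
      rw [show w.length + 1 + 1 - i = w.length + 1 - i + 1 by omega, Finset.sum_range_succ']
      simp [add_right_comm _ 1 i]
    rw [bar, ih, List.length_cons, Finset.sum_congr rfl e₁, Finset.sum_add_distrib]
    congr 1
    · rw [Finset.sum_Icc_succ_top (by omega)]
      simp
    · have h : Finset.Icc 1 (w.length + 1) = Finset.Ico (0 + 1) (w.length + 1 + 1) := by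
        ext
        simp
      rw [splitSum_eq_sum, Finset.range_eq_Ico, h, ← Finset.sum_Ico_add']
      rfl

end ListFn
end Golod

namespace Golod

section Grading

variable {Q : Type} [CommRing Q] {X : ℕ → Type} [∀ i, AddCommGroup (X i)] [∀ i, Module Q (X i)]

/-- Elements of a direct sum concentrated in degree `z`, for an integer `z`. -/
def homog (Q : Type) [CommRing Q] (X : ℕ → Type) [∀ i, AddCommGroup (X i)] [∀ i, Module Q (X i)]
    (z : ℤ) : Submodule Q (⨁ i, X i) where
  carrier := {x | ∀ i : ℕ, (i : ℤ) ≠ z → x i = 0}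
  add_mem' hx hy i hi := by rw [DirectSum.add_apply, hx i hi, hy i hi, add_zero]
  zero_mem' _ _ := rfl
  smul_mem' c x hx i hi := by rw [DirectSum.smul_apply, hx i hi, smul_zero]

theorem lof_mem_homog (i : ℕ) (x : X i) : DirectSum.lof Q ℕ X i x ∈ homog Q X i := fun j hj =>
  DFinsupp.single_eq_of_ne (by simpa using hj)

theorem eq_lof_of_mem_homog {i : ℕ} {x : ⨁ i, X i} (hx : x ∈ homog Q X i) :
    x = DirectSum.lof Q ℕ X i (x i) := by
  refine DFinsupp.ext fun j => ?_
  by_cases h : j = i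
  · subst h
    exact (DirectSum.of_eq_same _ _).symm
  · exact (hx j (by exact_mod_cast h)).trans (DirectSum.of_eq_of_ne _ _ _ h).symm

theorem eq_zero_of_mem_homog {z : ℤ} (hz : z < 0) {x : ⨁ i, X i} (hx : x ∈ homog Q X z) :
    x = 0 :=
  DFinsupp.ext fun j => hx j (by omega)

theorem mem_homog_cases {z : ℤ} {x : ⨁ i, X i} (hx : x ∈ homog Q X z) :
    x = 0 ∨ ∃ (i : ℕ) (y : X i), z = i ∧ x = DirectSum.lof Q ℕ X i y := by
  rcases lt_or_ge z 0 with h | h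
  · exact Or.inl (eq_zero_of_mem_homog h hx)
  · lift z to ℕ using h
    exact Or.inr ⟨z, x z, rfl, eq_lof_of_mem_homog hx⟩

end Grading

section Letters

variable {Q : Type} [CommRing Q] (C : Cx Q)

/-- Multiplication by the parity sign on `A_{≥1}[1]`. -/
noncomputable def Cx.sgn : C.plus →ₗ[Q] C.plus :=
  DirectSum.lmap fun i => ((-1 : ℤ) ^ i) • LinearMap.id

theorem Cx.sgn_incl (i : ℕ) (x : C.X (i + 1)) :
    C.sgn (C.incl i x) = ((-1 : ℤ) ^ i) • C.incl i x := by
  simp only [Cx.sgn, Cx.incl, DirectSum.lmap_lof, LinearMap.smul_apply, LinearMap.id_apply]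
  exact map_zsmul _ _ _

theorem Cx.plus_ext {V : Type*} [AddCommGroup V] [Module Q V] {f g : C.plus →ₗ[Q] V}
    (h : ∀ i x, f (C.incl i x) = g (C.incl i x)) (x : C.plus) : f x = g x := by
  have : f = g := DirectSum.linearMap_ext Q fun i => LinearMap.ext fun x => h i x
  rw [this]

theorem Cx.sgn_sgn (x : C.plus) : C.sgn (C.sgn x) = x :=
  C.plus_ext (f := C.sgn.comp C.sgn) (g := LinearMap.id) (fun i x => by
    simp [Cx.sgn_incl, smul_smul, ← mul_pow]) x

theorem Cx.sgn_mem {z : ℤ} {x : C.plus} (hx : x ∈ homog Q (fun i => C.X (i + 1)) z) :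
    C.sgn x ∈ homog Q (fun i => C.X (i + 1)) z := by
  rcases mem_homog_cases hx with rfl | ⟨i, y, rfl, rfl⟩
  · simp
  · have := C.sgn_incl i y
    rw [Cx.incl] at this
    rw [this]
    exact zsmul_mem (lof_mem_homog (X := fun i => C.X (i + 1)) i y) _

/-- The word with homogeneous letters prescribed by the first `n` terms of a sequence. -/
noncomputable def Cx.word (s : ℕ → Σ i, C.X (i + 1)) (n : ℕ) : List C.plus :=
  (List.range n).map fun l => C.incl (s l).1 (s l).2

/-- A sequence with a new first term. -/
def consSeq {α : Type*} (p : α) (s : ℕ → α) : ℕ → α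
  | 0 => p
  | n + 1 => s n

variable {C}

theorem Cx.word_consSeq (p : Σ i, C.X (i + 1)) (s : ℕ → Σ i, C.X (i + 1)) (n : ℕ) :
    C.word (consSeq p s) (n + 1) = C.incl p.1 p.2 :: C.word s n := by
  simp only [Cx.word, List.range_succ_eq_map, List.map_cons, List.map_map]
  rfl

@[simp]
theorem Cx.length_word (s : ℕ → Σ i, C.X (i + 1)) (n : ℕ) : (C.word s n).length = n := by
  simp [Cx.word]

/-- Words with homogeneous letters, of total degree `z` in the tensor powers of `A_{≥1}[1]`. -/
def WordDeg : List C.plus → ℤ → Prop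
  | [], z => z = 0
  | x :: w, z => ∃ p, x ∈ homog Q (fun i => C.X (i + 1)) p ∧ WordDeg w (z - p - 2)

theorem WordDeg.append {u v : List C.plus} {p q : ℤ} (hu : WordDeg u p) (hv : WordDeg v q) :
    WordDeg (u ++ v) (p + q) := by
  induction u generalizing p with
  | nil =>
    obtain rfl : p = 0 := hu
    simpa using hv
  | cons x u ih =>
    obtain ⟨r, hx, hu⟩ := hu
    refine ⟨r, hx, ?_⟩
    rw [show p + q - r - 2 = p - r - 2 + q by ring]
    exact ih hu

theorem WordDeg.split {u v : List C.plus} {z : ℤ} (h : WordDeg (u ++ v) z) :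
    ∃ p, WordDeg u p ∧ WordDeg v (z - p) := by
  induction u generalizing z with
  | nil => exact ⟨0, rfl, by simpa using h⟩
  | cons x u ih =>
    obtain ⟨r, hx, h⟩ := h
    obtain ⟨p, hu, hv⟩ := ih h
    refine ⟨p + r + 2, ⟨r, hx, ?_⟩, ?_⟩
    · rwa [show p + r + 2 - r - 2 = p by ring]
    · rwa [show z - (p + r + 2) = z - r - 2 - p by ring]

theorem WordDeg.map_sgn {w : List C.plus} {z : ℤ} (h : WordDeg w z) :
    WordDeg (w.map C.sgn) z := by
  induction w generalizing z with
  | nil => exact h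
  | cons x w ih =>
    obtain ⟨r, hx, h⟩ := h
    exact ⟨r, C.sgn_mem hx, ih h⟩

theorem wordDeg_word (s : ℕ → Σ i, C.X (i + 1)) (n : ℕ) :
    WordDeg (C.word s n) (∑ l ∈ Finset.range n, ((s l).1 + 2 : ℤ)) := by
  induction n with
  | zero => exact rfl
  | succ n ih =>
    rw [Finset.sum_range_succ, Cx.word, List.range_succ, List.map_append]
    exact ih.append ⟨(s n).1, lof_mem_homog _ _, by simp [WordDeg]⟩

theorem WordDeg.eq_word {w : List C.plus} {z : ℤ} (h : WordDeg w z) :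
    (0 : C.plus) ∈ w ∨ ∃ s : ℕ → Σ i, C.X (i + 1), w = C.word s w.length ∧
      z = ∑ l ∈ Finset.range w.length, ((s l).1 + 2 : ℤ) := by
  induction w generalizing z with
  | nil => exact Or.inr ⟨fun _ => ⟨0, 0⟩, rfl, h⟩
  | cons x w ih =>
    obtain ⟨p, hx, h⟩ := h
    rcases mem_homog_cases hx with rfl | ⟨i, y, rfl, rfl⟩
    · simp
    rcases ih h with h | ⟨s, hw, hz⟩
    · simp [h]
    · refine Or.inr ⟨consSeq ⟨i, y⟩ s, ?_, ?_⟩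
      · rw [List.length_cons, Cx.word_consSeq, ← hw, Cx.incl]
      · rw [List.length_cons, Finset.sum_range_succ']
        simp only [consSeq]
        linarith

theorem WordLinear.eq_zero_of_word {V : Type*} [AddCommGroup V] [Module Q V]
    {f : List C.plus → V} (hf : WordLinear Q f) {w : List C.plus}
    (h : ∀ s, f (C.word s w.length) = 0) : f w = 0 := by
  induction w generalizing f with
  | nil => exact h fun _ => ⟨0, 0⟩
  | cons y w ih =>
    refine C.plus_ext (f := (hf.head w).mk' (fun y => f (y :: w))) (g := 0) (fun i x => ?_) y
    refine ih (hf.cons _) fun s => ?_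
    rw [← Cx.word_consSeq ⟨i, x⟩]
    exact h _

/-- A nonempty word of nonpositive degree has a vanishing letter. -/
theorem WordDeg.zero_mem {w : List C.plus} {z : ℤ} (h : WordDeg w z) (hw : w ≠ [])
    (hz : z ≤ 1) : (0 : C.plus) ∈ w := by
  refine h.eq_word.resolve_right ?_
  rintro ⟨s, -, hs⟩
  have hpos : 0 < w.length := List.length_pos_iff.mpr hw
  have : (w.length : ℤ) * 2 ≤ ∑ l ∈ Finset.range w.length, ((s l).1 + 2 : ℤ) := by
    simpa using Finset.card_nsmul_le_sum (Finset.range w.length) (fun l => ((s l).1 + 2 : ℤ)) 2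
      (fun l _ => by simp)
  omega

theorem bar_mem_of_wordDeg {V : Type*} [AddCommGroup V] [Module Q V] {m : List C.plus → C.plus}
    (hm : ∀ w z, WordDeg w z → m w ∈ homog Q (fun i => C.X (i + 1)) (z - 3))
    (S : Submodule Q V) {f : List C.plus → V} {w : List C.plus} {z : ℤ} (hw : WordDeg w z)
    (hf : ∀ w, WordDeg w (z - 1) → f w ∈ S) : bar C.sgn m f w ∈ S := by
  induction w generalizing f z with
  | nil => exact S.zero_mem
  | cons x w ih =>
    have hw' := hw
    obtain ⟨p, hx, hw⟩ := hw
    refine S.add_mem (ih hw fun w h => hf _ ⟨p, C.sgn_mem hx, ?_⟩)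
      (splitSum_mem S fun u v huv => ?_)
    · rwa [show z - 1 - p - 2 = z - p - 2 - 1 by ring]
    · subst huv
      rw [← List.cons_append] at hw'
      obtain ⟨q, hu, hv⟩ := hw'.split
      refine hf _ ⟨q - 3, hm _ _ hu, ?_⟩
      rwa [show z - 1 - (q - 3) - 2 = z - q by ring]

theorem map_sgn_word_append {V : Type*} [AddCommGroup V] [Module Q V] {f : List C.plus → V}
    (hf : WordLinear Q f) (s : ℕ → Σ i, C.X (i + 1)) (n : ℕ) (v : List C.plus) :
    f ((C.word s n).map C.sgn ++ v)
      = ((-1 : ℤ) ^ (∑ l ∈ Finset.range n, (s l).1)) • f (C.word s n ++ v) := by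
  induction n generalizing v with
  | zero => simp [Cx.word]
  | succ n ih =>
    have e : C.word s (n + 1) = C.word s n ++ [C.incl (s n).1 (s n).2] := by
      simp [Cx.word, List.range_succ]
    rw [e, List.map_append, List.append_assoc, ih, Finset.sum_range_succ, pow_add, mul_smul]
    have := map_zsmul ((hf (C.word s n) v).mk' _) ((-1 : ℤ) ^ (s n).1) (C.incl (s n).1 (s n).2)
    simp only [IsLinearMap.mk'_apply] at this
    simp [Cx.sgn_incl, this]

theorem Cx.take_word (s : ℕ → Σ i, C.X (i + 1)) {j n : ℕ} (h : j ≤ n) :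
    (C.word s n).take j = C.word s j := by
  simp [Cx.word, ← List.map_take, List.take_range, h]

end Letters

end Golod

namespace Golod

section Algebra

variable {Q : Type} [CommRing Q] {C : Cx Q} {e0 : C.X 0 ≃ₗ[Q] Q} {m : AAlgStr C}

/-- The operations `m_n`, `n ≥ 1`, as a function on words; it vanishes on the empty word. -/
def AAlgStr.op (m : AAlgStr C) : List C.plus → C.plus :=
  listFn fun n => if n = 0 then 0 else m n

theorem AAlgStr.wordLinear_op (m : AAlgStr C) : WordLinear Q m.op := wordLinear_listFn _

theorem AAlgStr.op_eq {n : ℕ} (hn : n ≠ 0) {w : List C.plus} (v : Fin n → C.plus)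
    (hw : w = List.ofFn v) : m.op w = m n v := by
  rw [AAlgStr.op, listFn_eq _ v hw, if_neg hn]

theorem AAlgStr.op_nil : m.op [] = 0 := by
  simp [AAlgStr.op, listFn]

theorem AAlgStr.op_singleton (x : C.plus) : m.op [x] = m 1 (fun _ => x) :=
  AAlgStr.op_eq one_ne_zero _ (by simp)

theorem AAlgStr.op_pair (x y : C.plus) : m.op [x, y] = m 2 ![x, y] :=
  AAlgStr.op_eq two_ne_zero _ (by simp)

theorem Cx.getElem_word (s : ℕ → Σ i, C.X (i + 1)) (n i : ℕ) (h : i < (C.word s n).length) :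
    (C.word s n)[i] = C.incl (s i).1 (s i).2 :=
  (List.getElem_map _).trans
    (congrArg (fun l => C.incl (s l).1 (s l).2) (List.getElem_range _))

theorem Cx.word_eq_ofFn (s : ℕ → Σ i, C.X (i + 1)) (n : ℕ) :
    C.word s n = List.ofFn (fun j : Fin n => C.incl (s j).1 (s j).2) :=
  List.ext_getElem (by simp) fun i h₁ h₂ => by simp [Cx.getElem_word]

theorem bar_listFn_word {V : Type*} [AddCommGroup V] [Module Q V]
    (f : ∀ k : ℕ, MultilinearMap Q (fun _ : Fin k => C.plus) V)
    (s : ℕ → Σ i, C.X (i + 1)) (n : ℕ) :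
    bar C.sgn m.op (listFn f) (C.word s n)
      = ∑ i ∈ Finset.Icc 1 n, ∑ j ∈ Finset.range (n - i + 1),
        ((-1 : ℤ) ^ (∑ l ∈ Finset.range j, (s l).1)) •
          f (n - i + 1) (fun k : Fin (n - i + 1) =>
            if (k : ℕ) < j then C.incl (s k).1 (s k).2
            else if (k : ℕ) = j then
              m i (fun l : Fin i => C.incl (s (j + (l : ℕ))).1 (s (j + (l : ℕ))).2)
            else C.incl (s ((k : ℕ) + i - 1)).1 (s ((k : ℕ) + i - 1)).2) := by
  rw [bar_eq_sum, Cx.length_word]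
  refine Finset.sum_congr rfl fun i hi => ?_
  rw [Finset.mem_Icc] at hi
  rw [show n + 1 - i = n - i + 1 by omega]
  refine Finset.sum_congr rfl fun j hj => ?_
  rw [Finset.mem_range] at hj
  rw [C.take_word s (by omega), map_sgn_word_append (wordLinear_listFn f)]
  congr 1
  refine listFn_eq f _ (List.ext_getElem (by simp; omega) fun k h₁ h₂ => ?_)
  have e : m.op (((C.word s n).drop j).take i)
      = m i (fun l : Fin i => C.incl (s (j + (l : ℕ))).1 (s (j + (l : ℕ))).2) := by
    refine AAlgStr.op_eq (by omega) _ (List.ext_getElem (by simp; omega) fun k h₁ h₂ => ?_)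
    simp [Cx.getElem_word]
  simp only [e, List.getElem_ofFn]
  rcases lt_trichotomy k j with h | rfl | h
  · simp [h, Cx.getElem_word]
  · simp
  · obtain ⟨t, rfl⟩ := Nat.exists_eq_add_of_lt h
    have e₂ : j + i + t = j + t + 1 + i - 1 := by omega
    have e₃ : j + t + 1 - j = t + 1 := by omega
    simp [List.getElem_append, Cx.getElem_word, e₃, show ¬ j + t + 1 < j by omega,
      show ¬ j + t + 1 = j by omega]
    exact congrArg (fun l => C.incl (s l).1 (s l).2) e₂

/-- The curvature `d_1^A` as a linear form on `A_{≥1}`. -/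
noncomputable def Cx.curv (C : Cx Q) (e0 : C.X 0 ≃ₗ[Q] Q) : C.plus →ₗ[Q] Q :=
  DirectSum.toModule Q ℕ Q fun i => match i with
    | 0 => e0.toLinearMap.comp (C.d 0)
    | _ + 1 => 0

theorem Cx.curv_incl (i : ℕ) (x : C.X (i + 1)) : C.curv e0 (C.incl i x) = C.d1 e0 i x := by
  rw [Cx.curv, Cx.incl, DirectSum.toModule_lof]
  cases i <;> rfl

theorem Cx.curv_sgn (x : C.plus) : C.curv e0 (C.sgn x) = C.curv e0 x := by
  refine C.plus_ext (f := (C.curv e0).comp C.sgn) (fun i x => ?_) x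
  cases i with
  | zero => simp [Cx.sgn_incl]
  | succ i => simp [Cx.sgn_incl, Cx.curv_incl, Cx.d1]

namespace IsAInfAlg

theorem op_word_mem (hm : IsAInfAlg C e0 m) (s : ℕ → Σ i, C.X (i + 1)) (n : ℕ) :
    m.op (C.word s n) ∈ homog Q (fun i => C.X (i + 1))
      (∑ l ∈ Finset.range n, ((s l).1 + 2 : ℤ) - 3) := by
  rcases Nat.eq_zero_or_pos n with rfl | hn
  · rw [show C.word s 0 = [] from rfl, AAlgStr.op_nil]
    exact zero_mem _
  by_cases h : n = 1 ∧ (s 0).1 = 0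
  · obtain ⟨rfl, h⟩ := h
    rcases hs : s 0 with ⟨i, x⟩
    rw [hs] at h
    obtain rfl : i = 0 := h
    rw [show C.word s 1 = [C.incl (s 0).1 (s 0).2] from rfl, AAlgStr.op_singleton, hs, hm.2.2.1]
    exact zero_mem _
  · rw [AAlgStr.op_eq hn.ne' _ (C.word_eq_ofFn s n)]
    obtain ⟨y, hy⟩ := hm.1 n hn (fun l => (s l).1) (fun l => (s l).2)
    rw [← hy]
    have key : 3 ≤ ∑ l ∈ Finset.range n, (s l).1 + 2 * n := by
      by_cases h1 : n = 1
      · subst h1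
        simp only [Finset.sum_range_one]
        have : (s 0).1 ≠ 0 := fun h' => h ⟨rfl, h'⟩
        omega
      · omega
    have e : (∑ l ∈ Finset.range n, ((s l).1 + 2 : ℤ) - 3)
        = ((∑ l ∈ Finset.range n, (s l).1 + 2 * n - 3 : ℕ) : ℤ) := by
      rw [Nat.cast_sub key]
      push_cast
      rw [Finset.sum_add_distrib]
      simp [mul_comm]
    rw [e]
    exact lof_mem_homog (X := fun i => C.X (i + 1)) _ y

theorem op_mem (hm : IsAInfAlg C e0 m) {w : List C.plus} {z : ℤ} (h : WordDeg w z) :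
    m.op w ∈ homog Q (fun i => C.X (i + 1)) (z - 3) := by
  rcases h.eq_word with h | ⟨s, hw, rfl⟩
  · rw [m.wordLinear_op.eq_zero_of_mem h]
    exact zero_mem _
  · have := hm.op_word_mem s w.length
    rwa [← hw] at this

theorem sgn_op (hm : IsAInfAlg C e0 m) (w : List C.plus) :
    C.sgn (m.op w) = - m.op (w.map C.sgn) := by
  refine eq_neg_of_add_eq_zero_left (WordLinear.eq_zero_of_word
    ((m.wordLinear_op.map C.sgn).add (m.wordLinear_op.comp_map C.sgn)) fun s => ?_)
  have h₁ := map_sgn_word_append m.wordLinear_op s w.length []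
  simp only [List.append_nil] at h₁
  rw [h₁]
  rcases mem_homog_cases (hm.op_word_mem s w.length) with h | ⟨i, y, hz, h⟩
  · rw [h]
    simp
  · rw [h]
    have e := C.sgn_incl i y
    rw [Cx.incl] at e
    rw [e, ← add_smul]
    have hs : i + 3 = ∑ l ∈ Finset.range w.length, (s l).1 + 2 * w.length := by
      zify
      rw [← hz, Finset.sum_add_distrib]
      simp [mul_comm]
    have hp := congrArg (fun k => (-1 : ℤ) ^ k) hs
    simp only [pow_add, pow_mul] at hp
    norm_num at hp
    rw [← hp]
    simp

theorem bar_op_singleton (hm : IsAInfAlg C e0 m) (hC : C.IsComplex) (x : C.plus) :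
    bar C.sgn m.op m.op [x] = 0 := by
  simp only [bar, splitSum, zero_add, AAlgStr.op_singleton]
  have := C.plus_ext (f := ((m.wordLinear_op.head []).mk' (fun x => m.op [x])) ∘ₗ
    ((m.wordLinear_op.head []).mk' (fun x => m.op [x]))) (g := 0) (fun i x => ?_) x
  · simpa [AAlgStr.op_singleton] using this
  have h0 : m.op [0] = 0 := (m.wordLinear_op.head []).map_zero
  simp only [LinearMap.comp_apply, IsLinearMap.mk'_apply, LinearMap.zero_apply,
    AAlgStr.op_singleton] at h0 ⊢
  match i with
  | 0 => rw [hm.2.2.1, h0]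
  | 1 =>
    rw [hm.2.1, ← AAlgStr.op_singleton, (m.wordLinear_op.head []).map_neg,
      AAlgStr.op_singleton, hm.2.2.1, neg_zero]
  | i + 2 =>
    rw [hm.2.1, ← AAlgStr.op_singleton, (m.wordLinear_op.head []).map_neg,
      AAlgStr.op_singleton, hm.2.1, ← LinearMap.comp_apply (C.d (i + 1)), hC (i + 1)]
    simp

theorem bar_op_pair (hm : IsAInfAlg C e0 m) (x y : C.plus) :
    bar C.sgn m.op m.op [x, y] = C.curv e0 x • y - C.curv e0 y • x := by
  have hb := m.wordLinear_op.bar (σ := C.sgn) m.wordLinear_op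
  refine C.plus_ext (f := (hb.head [y]).mk' (fun x => bar C.sgn m.op m.op [x, y]))
    (g := (C.curv e0).smulRight y - C.curv e0 y • LinearMap.id) (fun i x => ?_) x
  refine C.plus_ext (f := (hb [C.incl i x] []).mk' _)
    (g := C.curv e0 (C.incl i x) • LinearMap.id - (C.curv e0).smulRight (C.incl i x))
    (fun j y => ?_) y
  have := hm.2.2.2.1 (consSeq i fun _ => j)
    (fun l => match l with | 0 => x | _ + 1 => y)
  simp only [consSeq, ← Cx.curv_incl, ← AAlgStr.op_pair, ← AAlgStr.op_singleton] at this
  simp only [IsLinearMap.mk'_apply, LinearMap.sub_apply, LinearMap.smul_apply, LinearMap.id_apply,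
    LinearMap.smulRight_apply, List.cons_append, List.nil_append, bar, splitSum, zero_add]
  refine Eq.trans ?_ this
  rw [Cx.sgn_incl]
  have e := map_zsmul ((m.wordLinear_op.head [m.op [C.incl j y]]).mk' _) ((-1 : ℤ) ^ i)
    (C.incl i x)
  simp only [IsLinearMap.mk'_apply] at e
  rw [e]
  exact (add_comm _ _).trans (congrArg (· + _) (add_comm _ _))

theorem bar_op_of_three_le (hm : IsAInfAlg C e0 m) (x y z : C.plus) (w : List C.plus) :
    bar C.sgn m.op m.op (x :: y :: z :: w) = 0 := by
  refine (m.wordLinear_op.bar (σ := C.sgn) m.wordLinear_op).eq_zero_of_word fun s => ?_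
  have h := hm.2.2.2.2 (w.length + 3) (by omega) (fun l => (s l).1) (fun l => (s l).2)
  rw [← h]
  refine (bar_listFn_word _ s _).trans ?_
  rfl

theorem curv_op (hm : IsAInfAlg C e0 m) (hC : C.IsComplex) (w : List C.plus) :
    C.curv e0 (m.op w) = 0 := by
  refine WordLinear.eq_zero_of_word (m.wordLinear_op.map (C.curv e0)) fun s => ?_
  by_cases h : w.length = 1
  · rcases hs : s 0 with ⟨i, x⟩
    rw [h, show C.word s 1 = [C.incl (s 0).1 (s 0).2] from rfl, hs, AAlgStr.op_singleton]
    match i with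
    | 0 => rw [hm.2.2.1, map_zero]
    | 1 =>
      rw [hm.2.1, map_neg, Cx.curv_incl, Cx.d1, ← LinearMap.comp_apply (C.d 0), hC 0]
      simp
    | i + 2 =>
      rw [hm.2.1, map_neg, Cx.curv_incl, Cx.d1, neg_zero]
  · rcases mem_homog_cases (hm.op_word_mem s w.length) with h' | ⟨i, y, hz, h'⟩
    · rw [h', map_zero]
    · rw [h']
      refine (Cx.curv_incl i y).trans ?_
      have : i ≠ 0 := by
        rintro rfl
        have hp : ∑ l ∈ Finset.range w.length, (s l).1 + 2 * w.length = 3 := by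
          zify
          rw [Finset.sum_add_distrib] at hz
          simp at hz
          linarith
        have : w.length = 0 := by omega
        simp [this] at hp
      obtain ⟨i, rfl⟩ := Nat.exists_eq_succ_of_ne_zero this
      rfl

end IsAInfAlg

end Algebra

end Golod

namespace Golod

section Lifting

variable {Q : Type*} [CommRing Q]

/-- Multilinear maps out of projective modules lift along surjections. -/
theorem MultilinearMap.exists_lift_of_surjective {k : ℕ} {P : Fin k → Type*}
    [∀ i, AddCommGroup (P i)] [∀ i, Module Q (P i)] [∀ i, Module.Projective Q (P i)]
    {N₁ N₂ : Type*} [AddCommGroup N₁] [Module Q N₁] [AddCommGroup N₂] [Module Q N₂]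
    (j : N₁ →ₗ[Q] N₂) (hj : Surjective j) (f : MultilinearMap Q P N₂) :
    ∃ f' : MultilinearMap Q P N₁, j.compMultilinearMap f' = f := by
  induction k generalizing N₁ N₂ with
  | zero =>
    obtain ⟨x, hx⟩ := hj (f finZeroElim)
    refine ⟨MultilinearMap.constOfIsEmpty Q P x, MultilinearMap.ext fun v => ?_⟩
    rw [Subsingleton.elim v finZeroElim]
    exact hx
  | succ k ih =>
    obtain ⟨g, hg⟩ := Module.projective_lifting_property (j.compMultilinearMapₗ Q) f.curryLeft
      (fun f => ih j hj f)
    refine ⟨g.uncurryLeft, MultilinearMap.ext fun v => ?_⟩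
    have := congrArg (fun h => h (v 0) (Fin.tail v)) hg
    simpa using this

theorem MultilinearMap.exists_lift {k : ℕ} {P : Fin k → Type*}
    [∀ i, AddCommGroup (P i)] [∀ i, Module Q (P i)] [∀ i, Module.Projective Q (P i)]
    {N₁ N₂ : Type*} [AddCommGroup N₁] [Module Q N₁] [AddCommGroup N₂] [Module Q N₂]
    (j : N₁ →ₗ[Q] N₂) (f : MultilinearMap Q P N₂) (hf : ∀ v, f v ∈ LinearMap.range j) :
    ∃ f' : MultilinearMap Q P N₁, ∀ v, j (f' v) = f v := by
  obtain ⟨f', hf'⟩ := MultilinearMap.exists_lift_of_surjective j.rangeRestrict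
    j.surjective_rangeRestrict (f.codRestrict _ hf)
  exact ⟨f', fun v => congrArg Subtype.val (congrArg (fun h => h v) hf')⟩

/-- Lifting of multilinear maps whose last argument is written in curried form. -/
theorem MultilinearMap.exists_lift_curried {k : ℕ} {P : Fin k → Type*}
    [∀ i, AddCommGroup (P i)] [∀ i, Module Q (P i)] [∀ i, Module.Projective Q (P i)]
    {Y N₁ N₂ : Type*} [AddCommGroup N₁] [Module Q N₁] [AddCommGroup N₂] [Module Q N₂]
    [AddCommGroup Y] [Module Q Y] [Module.Projective Q Y]
    (j : N₁ →ₗ[Q] N₂) (f : MultilinearMap Q P (Y →ₗ[Q] N₂))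
    (hf : ∀ v y, f v y ∈ LinearMap.range j) :
    ∃ f' : MultilinearMap Q P (Y →ₗ[Q] N₁), ∀ v y, j (f' v y) = f v y := by
  obtain ⟨f', hf'⟩ := MultilinearMap.exists_lift (LinearMap.compRight Q j (M := Y)) f fun v => by
    obtain ⟨g, hg⟩ := Module.projective_lifting_property j.rangeRestrict
      ((f v).codRestrict _ (hf v)) j.surjective_rangeRestrict
    exact ⟨g, LinearMap.ext fun y => congrArg Subtype.val (LinearMap.congr_fun hg y)⟩
  exact ⟨f', fun v y => LinearMap.congr_fun (hf' v) y⟩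

end Lifting

section Total

variable {Q : Type} [CommRing Q] (G : Cx Q) {M : Type} [AddCommGroup M] [Module Q M]

/-- The differential of the total module of a complex. -/
noncomputable def Cx.dT : Module.End Q G.total :=
  DirectSum.toModule Q ℕ G.total fun i => match i with
    | 0 => 0
    | i + 1 => (G.inclT i).comp (G.d i)

/-- The extension of an augmentation by zero to the total module. -/
noncomputable def Cx.augT (ε : G.X 0 →ₗ[Q] M) : G.total →ₗ[Q] M :=
  DirectSum.toModule Q ℕ M fun i => match i with
    | 0 => ε
    | _ + 1 => 0

theorem Cx.inclT_mem_homog (i : ℕ) (y : G.X i) : G.inclT i y ∈ homog Q G.X i :=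
  lof_mem_homog i y

theorem Cx.dT_zero (y : G.X 0) : G.dT (G.inclT 0 y) = 0 := by
  rw [Cx.dT, Cx.inclT, DirectSum.toModule_lof]
  rfl

theorem Cx.dT_succ (i : ℕ) (y : G.X (i + 1)) :
    G.dT (G.inclT (i + 1) y) = G.inclT i (G.d i y) := by
  rw [Cx.dT, Cx.inclT, DirectSum.toModule_lof]
  rfl

theorem Cx.augT_zero (ε : G.X 0 →ₗ[Q] M) (y : G.X 0) : G.augT ε (G.inclT 0 y) = ε y := by
  rw [Cx.augT, Cx.inclT, DirectSum.toModule_lof]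

theorem Cx.augT_succ (ε : G.X 0 →ₗ[Q] M) (i : ℕ) (y : G.X (i + 1)) :
    G.augT ε (G.inclT (i + 1) y) = 0 := by
  rw [Cx.augT, Cx.inclT, DirectSum.toModule_lof]
  rfl

variable {G}

theorem Cx.total_ext {V : Type*} [AddCommGroup V] [Module Q V] {f g : G.total →ₗ[Q] V}
    (h : ∀ i y, f (G.inclT i y) = g (G.inclT i y)) (y : G.total) : f y = g y := by
  have : f = g := DirectSum.linearMap_ext Q fun i => LinearMap.ext fun y => h i y
  rw [this]

theorem Cx.dT_mem {q : ℤ} {y : G.total} (hy : y ∈ homog Q G.X q) :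
    G.dT y ∈ homog Q G.X (q - 1) := by
  rcases mem_homog_cases hy with rfl | ⟨i, y, rfl, rfl⟩
  · simp
  · cases i with
    | zero =>
      rw [show G.dT (DirectSum.lof Q ℕ G.X 0 y) = 0 from G.dT_zero y]
      exact zero_mem _
    | succ i =>
      rw [show G.dT (DirectSum.lof Q ℕ G.X (i + 1) y) = _ from G.dT_succ i y]
      rw [show ((i + 1 : ℕ) : ℤ) - 1 = i by simp]
      exact lof_mem_homog (Q := Q) (X := G.X) i (G.d i y)

theorem Cx.augT_eq_zero (ε : G.X 0 →ₗ[Q] M) {q : ℤ} (hq : q ≠ 0) {y : G.total}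
    (hy : y ∈ homog Q G.X q) : G.augT ε y = 0 := by
  rcases mem_homog_cases hy with rfl | ⟨i, y, rfl, rfl⟩
  · simp
  · cases i with
    | zero => exact absurd rfl hq
    | succ i => exact G.augT_succ ε i y

theorem Cx.IsComplex.dT_dT (hG : G.IsComplex) (y : G.total) : G.dT (G.dT y) = 0 := by
  refine Cx.total_ext (f := G.dT ∘ₗ G.dT) (g := 0) (fun i y => ?_) y
  rw [LinearMap.comp_apply]
  match i with
  | 0 => rw [Cx.dT_zero, map_zero, LinearMap.zero_apply]
  | 1 => rw [Cx.dT_succ, Cx.dT_zero, LinearMap.zero_apply]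
  | i + 2 =>
    rw [Cx.dT_succ, Cx.dT_succ, ← LinearMap.comp_apply (G.d i), hG i]
    simp

theorem Cx.IsRes.augT_dT {ε : G.X 0 →ₗ[Q] M} (hG : G.IsRes M ε) (y : G.total) :
    G.augT ε (G.dT y) = 0 := by
  refine Cx.total_ext (f := G.augT ε ∘ₗ G.dT) (g := 0) (fun i y => ?_) y
  rw [LinearMap.comp_apply]
  match i with
  | 0 => rw [Cx.dT_zero, map_zero, LinearMap.zero_apply]
  | 1 =>
    rw [Cx.dT_succ, Cx.augT_zero, LinearMap.zero_apply, ← LinearMap.mem_ker, ← hG.2.2.1]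
    exact LinearMap.mem_range_self _ _
  | i + 2 => rw [Cx.dT_succ, Cx.augT_succ, LinearMap.zero_apply]

theorem Cx.IsRes.mem_range {ε : G.X 0 →ₗ[Q] M} (hG : G.IsRes M ε) {r : ℕ} {t : G.total}
    (ht : t ∈ homog Q G.X r) (hd : G.dT t = 0) (ha : G.augT ε t = 0) :
    t ∈ LinearMap.range ((G.inclT r).comp (G.d r)) := by
  have e := eq_lof_of_mem_homog ht
  have hinj : ∀ i, Injective (G.inclT i) := fun i => DirectSum.of_injective (β := G.X) i
  suffices h : t r ∈ LinearMap.range (G.d r) by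
    obtain ⟨y, hy⟩ := h
    exact ⟨y, by rw [LinearMap.comp_apply, hy, e]; simp [Cx.inclT]⟩
  change t = G.inclT r (t r) at e
  rw [e] at hd ha
  generalize t r = y at hd ha
  cases r with
  | zero => rwa [Cx.augT_zero, ← LinearMap.mem_ker, ← hG.2.2.1] at ha
  | succ r =>
    rw [Cx.dT_succ] at hd
    rw [hG.2.2.2, LinearMap.mem_ker]
    exact hinj r (hd.trans (map_zero _).symm)

end Total

end Golod

namespace Golod

section Words

variable {Q L V : Type*} [CommRing Q] [AddCommGroup L] [Module Q L] [AddCommGroup V] [Module Q V]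

theorem splitSum_eq_of_ne_nil {α : Type*} {F : List α → List α → V} {w : List α}
    (h : ∀ u v, u ++ v = w → u ≠ [] → F u v = 0) : splitSum F w = F [] w := by
  cases w with
  | nil => rfl
  | cons x w =>
    rw [splitSum, splitSum_eq_zero, add_zero]
    exact fun u v huv => h (x :: u) v (by simp [huv]) (by simp)

theorem splitSum_apply {α : Type*} (F : List α → List α → Module.End Q V) (w : List α) (y : V) :
    splitSum F w y = splitSum (fun u v => F u v y) w :=
  map_splitSum (LinearMap.applyₗ (R := Q) y).toAddMonoidHom F w

theorem ofLetter_of_two_le_length {L : Type*} (h : L → V) {w : List L} (hw : 2 ≤ w.length) :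
    ofLetter h w = 0 := by
  match w with
  | _ :: _ :: _ => rfl

theorem wordLinear_ofLetter (h : L →ₗ[Q] V) : WordLinear Q (ofLetter h) := by
  intro u v
  match u, v with
  | [], [] => exact h.isLinear
  | [], _ :: _ => exact ⟨fun _ _ => (add_zero 0).symm, fun c _ => (smul_zero c).symm⟩
  | [_], _ => exact ⟨fun _ _ => (add_zero 0).symm, fun c _ => (smul_zero c).symm⟩
  | _ :: _ :: _, _ => exact ⟨fun _ _ => (add_zero 0).symm, fun c _ => (smul_zero c).symm⟩

theorem wordLinear_defect {σ : L →ₗ[Q] L} {m : List L → L} (hm : WordLinear Q m)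
    (h : L →ₗ[Q] Q) {μ : List L → Module.End Q V} (hμ : WordLinear Q μ) :
    WordLinear Q (defect σ m h μ) := by
  refine ((hm.bar hμ).add (WordLinear.splitSum (fun v => ?_) fun u => ?_)).sub
    ((wordLinear_ofLetter h).map (LinearMap.toSpanSingleton Q _ 1))
  · exact (hμ.comp_map σ).map (LinearMap.mulRight Q (μ v))
  · exact hμ.map (LinearMap.mulLeft Q (μ (u.map σ)))

end Words

section Construction

variable {Q : Type} [CommRing Q] {C G : Cx Q}

/-- The family of higher actions `μ` has degree `-1`. -/
def IsDegNegOne (μ : List C.plus → Module.End Q G.total) : Prop :=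
  ∀ ⦃w z y q⦄, WordDeg w z → y ∈ homog Q G.X q → μ w y ∈ homog Q G.X (z + q - 1)

/-- The family of higher actions `μ` vanishes in total degrees below `n`. -/
def VanishesBelow (n : ℤ) (μ : List C.plus → Module.End Q G.total) : Prop :=
  ∀ ⦃w z y q⦄, WordDeg w z → y ∈ homog Q G.X q → z + q < n → μ w y = 0

/-- Membership in a submodule can be tested on words and elements with homogeneous entries. -/
theorem WordLinear.apply_mem (S : Submodule Q G.total) {f : List C.plus → Module.End Q G.total}
    (hf : WordLinear Q f) {w : List C.plus} {z : ℤ} (hw : WordDeg w z) {y : G.total} {q : ℤ}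
    (hy : y ∈ homog Q G.X q)
    (h : ∀ (s : ℕ → Σ i, C.X (i + 1)) (k g : ℕ) (y : G.X g),
      z = ∑ l ∈ Finset.range k, ((s l).1 + 2 : ℤ) → q = g →
      f (C.word s k) (G.inclT g y) ∈ S) : f w y ∈ S := by
  rcases hw.eq_word with h0 | ⟨s, hs, hz⟩
  · rw [hf.eq_zero_of_mem h0]
    exact S.zero_mem
  · rcases mem_homog_cases hy with rfl | ⟨g, y, hq, rfl⟩
    · rw [map_zero]
      exact S.zero_mem
    · rw [hs]
      exact h s _ g y hz hq

/-- Families of higher actions can be prescribed on homogeneous arguments. -/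
theorem exists_wordLinear
    (F : ∀ (k : ℕ) (a : Fin k → ℕ) (g : ℕ),
      MultilinearMap Q (fun i => C.X (a i + 1)) (G.X g →ₗ[Q] G.total)) :
    ∃ μ : List C.plus → Module.End Q G.total, WordLinear Q μ ∧
      ∀ (s : ℕ → Σ i, C.X (i + 1)) (k g : ℕ) (y : G.X g),
        μ (C.word s k) (G.inclT g y)
          = F k (fun i => (s i).1) g (fun i => (s i).2) y := by
  let E (g k : ℕ) : MultilinearMap Q (fun _ : Fin k => C.plus) (G.X g →ₗ[Q] G.total) :=
    MultilinearMap.fromDirectSumEquiv (R := Q) (κ := fun _ : Fin k => ℕ)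
      (M := fun _ i => C.X (i + 1))
      (M' := G.X g →ₗ[Q] G.total) fun a => F k a g
  have hE : WordLinear Q fun w => DirectSum.toModule Q ℕ G.total
      (fun g => listFn (E g) w) := by
    intro u v
    refine ⟨fun x y => DirectSum.linearMap_ext Q fun g => LinearMap.ext fun t => ?_,
      fun c x => DirectSum.linearMap_ext Q fun g => LinearMap.ext fun t => ?_⟩
    · simp [(wordLinear_listFn (E g) u v).map_add]
    · simp [(wordLinear_listFn (E g) u v).map_smul]
  refine ⟨_, hE, fun s k g y => ?_⟩
  rw [Cx.inclT, DirectSum.toModule_lof, listFn_eq (E g) _ (C.word_eq_ofFn s k)]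
  exact LinearMap.congr_fun (MultilinearMap.fromDirectSumEquiv_lof
    (R := Q) (κ := fun _ : Fin k => ℕ) (M := fun _ i => C.X (i + 1))
    (M' := G.X g →ₗ[Q] G.total) (fun a => F k a g)
    (fun i => (s i).1) (fun i => (s i).2)) y

/-- The restriction of a family of higher actions to homogeneous arguments. -/
noncomputable def WordLinear.component {μ : List C.plus → Module.End Q G.total}
    (hμ : WordLinear Q μ) (k : ℕ) (a : Fin k → ℕ) (g : ℕ) :
    MultilinearMap Q (fun i => C.X (a i + 1)) (G.X g →ₗ[Q] G.total) :=
  (LinearMap.lcomp Q G.total (G.inclT g)).compMultilinearMap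
    ((hμ.toMultilinear k).compLinearMap fun i => C.incl (a i))

theorem WordLinear.component_apply {μ : List C.plus → Module.End Q G.total}
    (hμ : WordLinear Q μ) {k : ℕ} (a : Fin k → ℕ) (g : ℕ) (x : ∀ i, C.X (a i + 1)) (y : G.X g) :
    hμ.component k a g x y = μ (List.ofFn fun i => C.incl (a i) (x i)) (G.inclT g y) :=
  rfl

variable {e0 : C.X 0 ≃ₗ[Q] Q} {m : AAlgStr C}

theorem IsAInfAlg.bar_apply_mem (hm : IsAInfAlg C e0 m) (S : Submodule Q G.total)
    {f : List C.plus → Module.End Q G.total} {w : List C.plus} {z : ℤ} (hw : WordDeg w z)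
    {y : G.total} (hf : ∀ w, WordDeg w (z - 1) → f w y ∈ S) : bar C.sgn m.op f w y ∈ S :=
  bar_mem_of_wordDeg (m := m.op) (fun _ _ h => hm.op_mem h)
    (S.comap (LinearMap.applyₗ (R := Q) (M := G.total) (M₂ := G.total) y)) hw hf

theorem IsAInfAlg.defect_mem (hm : IsAInfAlg C e0 m) {μ : List C.plus → Module.End Q G.total}
    (hd : IsDegNegOne μ) {w : List C.plus} {z : ℤ} (hw : WordDeg w z) {y : G.total} {q : ℤ}
    (hy : y ∈ homog Q G.X q) :
    defect C.sgn m.op (C.curv e0) μ w y ∈ homog Q G.X (z + q - 2) := by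
  refine Submodule.sub_mem _ (Submodule.add_mem _ ?_ ?_) ?_
  · refine hm.bar_apply_mem _ hw fun w hw => ?_
    have := hd hw hy
    rwa [show z - 1 + q - 1 = z + q - 2 by ring] at this
  · rw [splitSum_apply]
    refine splitSum_mem _ fun u v huv => ?_
    subst huv
    obtain ⟨p, hu, hv⟩ := hw.split
    have := hd hu.map_sgn (hd hv hy)
    rwa [show p + (z - p + q - 1) - 1 = z + q - 2 by ring] at this
  · match w, hw with
    | [], _ => simp [ofLetter]
    | [x], ⟨p, hx, h⟩ =>
      have hz : z = p + 2 := by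
        have : z - p - 2 = 0 := h
        omega
      rcases mem_homog_cases hx with rfl | ⟨i, x, rfl, rfl⟩
      · simp [ofLetter]
      cases i with
      | zero =>
        rw [hz, show ((0 : ℕ) : ℤ) + 2 + q - 2 = q by simp]
        exact Submodule.smul_mem _ _ hy
      | succ i =>
        have : C.curv e0 (DirectSum.lof Q ℕ (fun i => C.X (i + 1)) (i + 1) x) = 0 :=
          C.curv_incl (i + 1) x
        simp [ofLetter, this]
    | _ :: _ :: _, _ => simp [ofLetter]

theorem defect_add_apply (hm : IsAInfAlg C e0 m) {μ ν : List C.plus → Module.End Q G.total}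
    (hμ : WordLinear Q μ) (hd' : IsDegNegOne fun w => μ w + ν w)
    {n : ℤ} (hν : VanishesBelow n ν) {w : List C.plus} {z : ℤ} (hw : WordDeg w z)
    {y : G.total} {q : ℤ} (hy : y ∈ homog Q G.X q) (hn : z + q ≤ n) :
    defect C.sgn m.op (C.curv e0) (fun w => μ w + ν w) w y
      = defect C.sgn m.op (C.curv e0) μ w y + μ [] (ν w y) := by
  have h₁ : bar C.sgn m.op ν w y = 0 :=
    (Submodule.mem_bot Q).mp <| hm.bar_apply_mem _ hw fun w hw =>
      (Submodule.mem_bot Q).mpr <| hν hw hy (by linarith)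
  have h₂ : splitSum (fun u v => ν (u.map C.sgn) * (μ v + ν v)) w y = 0 := by
    rw [splitSum_apply]
    refine splitSum_eq_zero fun u v huv => ?_
    subst huv
    obtain ⟨p, hu, hv⟩ := hw.split
    exact hν hu.map_sgn (hd' hv hy) (by linarith)
  have h₃ : splitSum (fun u v => μ (u.map C.sgn) * ν v) w y = μ [] (ν w y) := by
    rw [splitSum_apply, splitSum_eq_of_ne_nil]
    · rfl
    intro u v huv hne
    subst huv
    obtain ⟨p, hu, hv⟩ := hw.split
    by_cases hp : p ≤ 1
    · have : (0 : C.plus) ∈ u.map C.sgn :=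
        List.mem_map.mpr ⟨0, hu.zero_mem hne hp, map_zero _⟩
      rw [hμ.eq_zero_of_mem this, zero_mul, LinearMap.zero_apply]
    · rw [Module.End.mul_apply, hν hv hy (by linarith), map_zero]
  have e : splitSum (fun u v => (μ (u.map C.sgn) + ν (u.map C.sgn)) * (μ v + ν v)) w
      = splitSum (fun u v => μ (u.map C.sgn) * μ v) w
        + splitSum (fun u v => μ (u.map C.sgn) * ν v) w
        + splitSum (fun u v => ν (u.map C.sgn) * (μ v + ν v)) w := by
    rw [← splitSum_add, ← splitSum_add]
    exact splitSum_congr fun u v _ => by noncomm_ring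
  simp only [defect, bar_add, e, LinearMap.add_apply, LinearMap.sub_apply, h₁, h₂, h₃]
  abel

theorem dT_defect (hC : C.IsComplex) (hm : IsAInfAlg C e0 m)
    {μ : List C.plus → Module.End Q G.total} (hμ : WordLinear Q μ) (hd : IsDegNegOne μ)
    (h0 : μ [] = G.dT) {n : ℤ} (hR : VanishesBelow n (defect C.sgn m.op (C.curv e0) μ))
    {w : List C.plus} {z : ℤ} (hw : WordDeg w z) {y : G.total} {q : ℤ}
    (hy : y ∈ homog Q G.X q) (hn : z + q ≤ n) :
    G.dT (defect C.sgn m.op (C.curv e0) μ w y) = 0 := by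
  have key := LinearMap.congr_fun (bar_defect C.sgn_sgn hm.sgn_op (C.curv e0)
    (hm.bar_op_singleton hC) hm.bar_op_pair hm.bar_op_of_three_le C.curv_sgn
    (hm.curv_op hC) hμ w) y
  have h₁ : bar C.sgn m.op (defect C.sgn m.op (C.curv e0) μ) w y = 0 :=
    (Submodule.mem_bot Q).mp <| hm.bar_apply_mem _ hw fun w hw =>
      (Submodule.mem_bot Q).mpr <| hR hw hy (by linarith)
  have h₂ : splitSum (fun u v => defect C.sgn m.op (C.curv e0) μ (u.map C.sgn) * μ v) w y = 0 := by
    rw [splitSum_apply]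
    refine splitSum_eq_zero fun u v huv => ?_
    subst huv
    obtain ⟨p, hu, hv⟩ := hw.split
    exact hR hu.map_sgn (hd hv hy) (by linarith)
  rw [h₁, LinearMap.sub_apply, h₂, sub_zero, splitSum_apply, splitSum_eq_of_ne_nil] at key
  · rw [← h0]
    exact key.symm
  intro u v huv hne
  subst huv
  obtain ⟨p, hu, hv⟩ := hw.split
  by_cases hp : p ≤ 1
  · rw [hμ.eq_zero_of_mem (hu.zero_mem hne hp), zero_mul, LinearMap.zero_apply]
  · rw [Module.End.mul_apply, hR hv hy (by linarith), map_zero]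

theorem augT_defect {M : Type} [AddCommGroup M] [Module Q M] {ε : G.X 0 →ₗ[Q] M}
    (hG : G.IsRes M ε) (hM : ∀ (x : C.plus) (t : M), C.curv e0 x • t = 0)
    (hm : IsAInfAlg C e0 m)
    {μ : List C.plus → Module.End Q G.total} (hμ : WordLinear Q μ) (hd : IsDegNegOne μ)
    (h0 : μ [] = G.dT) {w : List C.plus} {z : ℤ} (hw : WordDeg w z) {y : G.total} {q : ℤ}
    (hy : y ∈ homog Q G.X q) :
    G.augT ε (defect C.sgn m.op (C.curv e0) μ w y) = 0 := by
  have key : ∀ {w z y q}, WordDeg w z → y ∈ homog Q G.X q → G.augT ε (μ w y) = 0 := by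
    intro w z y q hw hy
    by_cases hne : w = []
    · rw [hne, h0, hG.augT_dT]
    by_cases hz : z ≤ 1
    · rw [hμ.eq_zero_of_mem (hw.zero_mem hne hz), LinearMap.zero_apply, map_zero]
    rcases lt_or_ge q 0 with hq | hq
    · rw [eq_zero_of_mem_homog hq hy, map_zero, map_zero]
    · exact Cx.augT_eq_zero ε (by omega) (hd hw hy)
  have h₁ : G.augT ε (bar C.sgn m.op μ w y) = 0 :=
    hm.bar_apply_mem (LinearMap.ker (G.augT ε)) hw fun w hw => key hw hy
  have h₂ : G.augT ε (splitSum (fun u v => μ (u.map C.sgn) * μ v) w y) = 0 := by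
    rw [splitSum_apply]
    refine splitSum_mem (LinearMap.ker (G.augT ε)) fun u v huv => ?_
    subst huv
    obtain ⟨p, hu, hv⟩ := hw.split
    exact key hu.map_sgn (hd hv hy)
  have h₃ : ofLetter (C.curv e0) w • G.augT ε y = 0 := by
    match w with
    | [] => exact zero_smul _ _
    | [x] => exact hM x _
    | _ :: _ :: _ => exact zero_smul _ _
  simp [defect, h₁, h₂, h₃]

end Construction

end Golod

namespace Golod

section Existence

variable {Q : Type} [CommRing Q] {C G : Cx Q} {e0 : C.X 0 ≃ₗ[Q] Q} {m : AAlgStr C}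

/-- A family of higher actions of degree `-1` extending the differential and satisfying the
module Stasheff relations in total degrees below `n`. -/
structure IsPartialAction (e0 : C.X 0 ≃ₗ[Q] Q) (m : AAlgStr C) (n : ℤ)
    (μ : List C.plus → Module.End Q G.total) : Prop where
  wordLinear : WordLinear Q μ
  map_nil : μ [] = G.dT
  isDegNegOne : IsDegNegOne μ
  vanishesBelow_defect : VanishesBelow n (defect C.sgn m.op (C.curv e0) μ)

theorem wordDeg_ofFn {k : ℕ} (a : Fin k → ℕ) (x : ∀ i, C.X (a i + 1)) :
    WordDeg (List.ofFn fun i => C.incl (a i) (x i)) (∑ i, (a i + 2 : ℤ)) := by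
  induction k with
  | zero => exact rfl
  | succ k ih =>
    rw [List.ofFn_succ, Fin.sum_univ_succ]
    refine ⟨a 0, lof_mem_homog _ _, ?_⟩
    rw [sub_sub, add_sub_cancel_left]
    exact ih _ fun i => x i.succ

theorem defect_nil (hG : G.IsComplex) (h : C.plus →ₗ[Q] Q) {f : List C.plus → C.plus}
    {μ : List C.plus → Module.End Q G.total} (h0 : μ [] = G.dT) :
    defect C.sgn f h μ [] = 0 := by
  refine LinearMap.ext fun y => ?_
  simp [defect, bar, splitSum, ofLetter, h0, hG.dT_dT]

theorem VanishesBelow.mono {n n' : ℤ} (h : n ≤ n') {μ : List C.plus → Module.End Q G.total}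
    (hμ : VanishesBelow n' μ) : VanishesBelow n μ :=
  fun _ _ _ _ hw hy hn => hμ hw hy (hn.trans_le h)

/-- Correcting terms for a partial action in a fixed multidegree. -/
theorem IsPartialAction.exists_correction {M : Type} [AddCommGroup M] [Module Q M]
    {ε : G.X 0 →ₗ[Q] M} (hC : C.IsComplex) (hCp : ∀ i, Module.Projective Q (C.X i))
    (hG : G.IsProjRes M ε) (hM : ∀ (x : C.plus) (t : M), C.curv e0 x • t = 0)
    (hm : IsAInfAlg C e0 m) {n : ℕ} {μ : List C.plus → Module.End Q G.total}
    (h : IsPartialAction e0 m n μ) {k : ℕ} (a : Fin k → ℕ) (g : ℕ)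
    (hn : ∑ i, (a i + 2 : ℤ) + g = n) :
    ∃ F : MultilinearMap Q (fun i => C.X (a i + 1)) (G.X g →ₗ[Q] G.total),
      ∀ x y, F x y ∈ homog Q G.X (n - 1) ∧ G.dT (F x y) =
        - defect C.sgn m.op (C.curv e0) μ (List.ofFn fun i => C.incl (a i) (x i))
          (G.inclT g y) := by
  have hR := wordLinear_defect (σ := C.sgn) m.wordLinear_op (C.curv e0) h.wordLinear
  have hmem : ∀ (x : ∀ i, C.X (a i + 1)) (y : G.X g), defect C.sgn m.op (C.curv e0) μ
      (List.ofFn fun i => C.incl (a i) (x i)) (G.inclT g y) ∈ homog Q G.X (n - 2) := by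
    intro x y
    rw [← hn]
    exact hm.defect_mem h.isDegNegOne (wordDeg_ofFn a x) (G.inclT_mem_homog g y)
  by_cases h2 : n < 2
  · refine ⟨0, fun x y => ⟨Submodule.zero_mem _, ?_⟩⟩
    rw [eq_zero_of_mem_homog (by omega) (hmem x y)]
    simp
  obtain ⟨r, rfl⟩ := Nat.exists_eq_add_of_le (not_lt.mp h2)
  have := hCp
  have := hG.2
  obtain ⟨F, hF⟩ := MultilinearMap.exists_lift_curried ((G.inclT r).comp (G.d r))
    (hR.component k a g) fun x y => hG.1.mem_range
      (by simpa [hR.component_apply] using hmem x y)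
      (dT_defect hC hm h.wordLinear h.isDegNegOne h.map_nil h.vanishesBelow_defect
        (wordDeg_ofFn a x) (G.inclT_mem_homog g y) hn.le)
      (augT_defect hG.1 hM hm h.wordLinear h.isDegNegOne h.map_nil
        (wordDeg_ofFn a x) (G.inclT_mem_homog g y))
  refine ⟨(LinearMap.compRight Q (- G.inclT (r + 1))).compMultilinearMap F, fun x y => ⟨?_, ?_⟩⟩
  · have := (homog Q G.X (r + 1 : ℕ)).neg_mem (lof_mem_homog (X := G.X) (r + 1) (F x y))
    rw [show ((2 + r : ℕ) : ℤ) - 1 = (r + 1 : ℕ) by push_cast; ring]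
    exact this
  · have := hF x y
    rw [LinearMap.comp_apply, ← Cx.dT_succ, hR.component_apply] at this
    rw [← this]
    exact map_neg _ _

theorem IsPartialAction.exists_succ {M : Type} [AddCommGroup M] [Module Q M]
    {ε : G.X 0 →ₗ[Q] M} (hC : C.IsComplex) (hCp : ∀ i, Module.Projective Q (C.X i))
    (hG : G.IsProjRes M ε) (hM : ∀ (x : C.plus) (t : M), C.curv e0 x • t = 0)
    (hm : IsAInfAlg C e0 m) {n : ℕ} {μ : List C.plus → Module.End Q G.total}
    (h : IsPartialAction e0 m n μ) :
    ∃ μ', IsPartialAction e0 m (n + 1 : ℕ) μ' ∧ VanishesBelow n (fun w => μ' w - μ w) := by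
  have hR := wordLinear_defect (σ := C.sgn) m.wordLinear_op (C.curv e0) h.wordLinear
  have key : ∀ (k : ℕ) (a : Fin k → ℕ) (g : ℕ),
      ∃ F : MultilinearMap Q (fun i => C.X (a i + 1)) (G.X g →ₗ[Q] G.total),
        (k = 0 ∨ ∑ i, (a i + 2 : ℤ) + g ≠ n → F = 0) ∧
        (k ≠ 0 → ∑ i, (a i + 2 : ℤ) + g = n → ∀ x y, F x y ∈ homog Q G.X (n - 1) ∧
          G.dT (F x y) = - defect C.sgn m.op (C.curv e0) μ
            (List.ofFn fun i => C.incl (a i) (x i)) (G.inclT g y)) := by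
    intro k a g
    by_cases hk : k = 0 ∨ ∑ i, (a i + 2 : ℤ) + g ≠ n
    · exact ⟨0, fun _ => rfl, fun h₁ h₂ => absurd hk (by tauto)⟩
    · obtain ⟨F, hF⟩ := h.exists_correction hC hCp hG hM hm a g (by tauto)
      exact ⟨F, fun h => absurd h hk, fun _ _ => hF⟩
  choose F hF₀ hF using key
  obtain ⟨ν, hν, hνF⟩ := exists_wordLinear F
  have hν0 : ν [] = 0 := LinearMap.ext fun y => Cx.total_ext (g := 0) (fun g y => by
    have := hνF (fun _ => ⟨0, 0⟩) 0 g y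
    rw [hF₀ _ _ _ (Or.inl rfl)] at this
    exact this) y
  have hdν : IsDegNegOne ν := fun w z y q hw hy => by
    refine hν.apply_mem _ hw hy fun s k g y hz hq => ?_
    rw [hνF]
    rw [← Fin.sum_univ_eq_sum_range (fun l => ((s l).1 + 2 : ℤ))] at hz
    by_cases hk : k = 0 ∨ ∑ i : Fin k, ((s i).1 + 2 : ℤ) + g ≠ n
    · rw [hF₀ _ _ _ hk]
      exact Submodule.zero_mem _
    · rw [not_or, not_ne_iff] at hk
      rw [hz, hq, hk.2]
      exact (hF _ _ _ hk.1 hk.2 _ _).1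
  have hvν : VanishesBelow n ν := fun w z y q hw hy hn => by
    refine (Submodule.mem_bot Q).mp (hν.apply_mem _ hw hy fun s k g y hz hq => ?_)
    rw [← Fin.sum_univ_eq_sum_range (fun l => ((s l).1 + 2 : ℤ))] at hz
    rw [hνF, hF₀ _ _ _ (Or.inr (by rw [← hz, ← hq]; exact hn.ne))]
    exact Submodule.zero_mem _
  have hd : IsDegNegOne fun w => μ w + ν w := fun w z y q hw hy =>
    Submodule.add_mem _ (h.isDegNegOne hw hy) (hdν hw hy)
  refine ⟨fun w => μ w + ν w, ⟨h.wordLinear.add hν, ?_, hd, fun w z y q hw hy hn => ?_⟩, ?_⟩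
  · simp only [hν0, h.map_nil, add_zero]
  · have hn' : z + q ≤ n := by push_cast at hn; omega
    rw [defect_add_apply hm h.wordLinear hd hvν hw hy hn', h.map_nil]
    rcases hn'.lt_or_eq with hlt | heq
    · rw [h.vanishesBelow_defect hw hy hlt, hvν hw hy hlt, map_zero, add_zero]
    refine (Submodule.mem_bot Q).mp ((hR.add (hν.map (LinearMap.mulLeft Q G.dT))).apply_mem _
      hw hy fun s k g y hz hq => ?_)
    rw [← Fin.sum_univ_eq_sum_range (fun l => ((s l).1 + 2 : ℤ))] at hz
    rw [Submodule.mem_bot, LinearMap.add_apply, LinearMap.mulLeft_apply, Module.End.mul_apply]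
    by_cases hk : k = 0
    · subst hk
      rw [show C.word s 0 = [] from rfl, defect_nil hG.1.1 _ h.map_nil, hν0]
      simp
    · rw [hνF, (hF _ _ _ hk (by rw [← hz, ← hq]; exact heq) _ _).2, ← C.word_eq_ofFn]
      exact add_neg_cancel _
  · simpa using hvν

theorem exists_isPartialAction_zero (hm : IsAInfAlg C e0 m) :
    ∃ μ : List C.plus → Module.End Q G.total, IsPartialAction e0 m 0 μ := by
  classical
  have hd : IsDegNegOne fun w : List C.plus => if w = [] then G.dT else 0 := by
    intro w z y q hw hy
    by_cases h : w = []
    · subst h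
      obtain rfl : z = 0 := hw
      simpa using Cx.dT_mem hy
    · simp [h]
  refine ⟨_, fun u v => ⟨fun x y => ?_, fun c x => ?_⟩, if_pos rfl, hd, fun w z y q hw hy hn => ?_⟩
  · simp
  · simp
  · exact eq_zero_of_mem_homog (by omega) (hm.defect_mem hd hw hy)

theorem exists_forall_isPartialAction {M : Type} [AddCommGroup M] [Module Q M]
    {ε : G.X 0 →ₗ[Q] M} (hC : C.IsComplex) (hCp : ∀ i, Module.Projective Q (C.X i))
    (hG : G.IsProjRes M ε) (hM : ∀ (x : C.plus) (t : M), C.curv e0 x • t = 0)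
    (hm : IsAInfAlg C e0 m) :
    ∃ μ : List C.plus → Module.End Q G.total, ∀ n : ℕ, IsPartialAction e0 m n μ := by
  let step (n : ℕ) (p : {μ : List C.plus → Module.End Q G.total // IsPartialAction e0 m n μ}) :
      {μ : List C.plus → Module.End Q G.total // IsPartialAction e0 m (n + 1 : ℕ) μ} :=
    ⟨_, (p.2.exists_succ hC hCp hG hM hm).choose_spec.1⟩
  let S (n : ℕ) : {μ : List C.plus → Module.End Q G.total // IsPartialAction e0 m n μ} :=
    Nat.rec ⟨_, (exists_isPartialAction_zero hm).choose_spec⟩ step n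
  have hstep : ∀ n : ℕ, VanishesBelow n fun w => (S (n + 1)).1 w - (S n).1 w := fun n =>
    ((S n).2.exists_succ hC hCp hG hM hm).choose_spec.2
  have hS : ∀ n N : ℕ, n ≤ N → VanishesBelow n fun w => (S N).1 w - (S n).1 w := by
    intro n N h
    induction N, h using Nat.le_induction with
    | base => exact fun w z y q _ _ _ => by simp
    | succ N h ih =>
      intro w z y q hw hy hn
      have h₁ := (hstep N).mono (by exact_mod_cast h) hw hy hn
      have h₂ := ih hw hy hn
      rw [LinearMap.sub_apply, sub_eq_zero] at h₁ h₂ ⊢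
      rw [h₁, h₂]
  obtain ⟨μ, hμ, hμF⟩ := exists_wordLinear fun k a g =>
    (S (∑ i : Fin k, (a i + 2) + g + 1)).2.wordLinear.component k a g
  have hμS : ∀ n : ℕ, VanishesBelow n fun w => μ w - (S n).1 w := by
    intro n w z y q hw hy hn
    refine (Submodule.mem_bot Q).mp
      ((hμ.sub (S n).2.wordLinear).apply_mem _ hw hy fun s k g y hz hq => ?_)
    have hz' := hz
    rw [← Fin.sum_univ_eq_sum_range (fun l => ((s l).1 + 2 : ℤ))] at hz'
    have ht : ((∑ i : Fin k, ((s i).1 + 2) + g : ℕ) : ℤ) = z + q := by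
      rw [hz', hq]
      push_cast
      rfl
    have := hS (∑ i : Fin k, ((s i).1 + 2) + g + 1) n (by omega) (hz ▸ wordDeg_word s k)
      (hq ▸ G.inclT_mem_homog g y) (by push_cast at ht ⊢; linarith)
    rw [LinearMap.sub_apply, sub_eq_zero] at this
    rw [Submodule.mem_bot, LinearMap.sub_apply, hμF, WordLinear.component_apply,
      ← C.word_eq_ofFn, sub_eq_zero]
    exact this.symm
  have happ : ∀ (n : ℕ) {w z y q}, WordDeg w z → y ∈ homog Q G.X q → z + q < n →
      μ w y = (S n).1 w y := fun n w z y q hw hy hn => by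
    have := hμS n hw hy hn
    rwa [LinearMap.sub_apply, sub_eq_zero] at this
  have hd : IsDegNegOne μ := fun w z y q hw hy => by
    rw [happ ((z + q).toNat + 1) hw hy (by omega)]
    exact (S _).2.isDegNegOne hw hy
  have hadd : ∀ n : ℕ, (fun w => (S n).1 w + (μ w - (S n).1 w)) = μ := fun n =>
    funext fun w => add_sub_cancel _ _
  refine ⟨μ, fun n => ⟨hμ, ?_, hd, fun w z y q hw hy hn => ?_⟩⟩
  · refine LinearMap.ext fun y => Cx.total_ext (fun g y => ?_) y
    rw [happ (g + 1) (w := []) (z := 0) rfl (G.inclT_mem_homog g y) (by push_cast; omega),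
      (S _).2.map_nil]
  · have := defect_add_apply hm (S n).2.wordLinear (by rwa [hadd]) (hμS n) hw hy hn.le
    rw [hadd, (S n).2.vanishesBelow_defect hw hy hn, hμS n hw hy hn, map_zero, add_zero] at this
    exact this

end Existence

end Golod

namespace Golod

section Translation

variable {Q : Type} [CommRing Q] {C G : Cx Q} {e0 : C.X 0 ≃ₗ[Q] Q} {m : AAlgStr C}

/-- A family of higher actions of degree `-1` without defect is an A∞-module structure. -/
theorem isAInfMod_of_listFn 
    {mG : ∀ k : ℕ, MultilinearMap Q (fun _ : Fin k => C.plus) (Module.End Q G.total)}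
    (h0 : listFn mG [] = G.dT)
    (hd : IsDegNegOne (listFn mG))
    (hR : ∀ (s : ℕ → Σ i, C.X (i + 1)) (k g : ℕ) (y : G.X g),
      defect C.sgn m.op (C.curv e0) (listFn mG) (C.word s k) (G.inclT g y) = 0) :
    IsAInfMod C e0 m G mG := by
  have hword : ∀ (k : ℕ) (a : ℕ → ℕ) (x : ∀ l, C.X (a l + 1)),
      listFn mG (C.word (fun l => ⟨a l, x l⟩) k) = mG k (fun j => C.incl (a j) (x j)) :=
    fun k a x => listFn_eq mG _ (C.word_eq_ofFn _ _)
  have h0' : mG 0 ![] = G.dT := by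
    rw [← h0]
    exact (listFn_eq mG _ (by simp)).symm
  have h1 : ∀ x, listFn mG [x] = mG 1 ![x] := fun x => listFn_eq mG _ (by simp)
  refine ⟨fun k a x g y => ?_, fun i y => ?_, fun y => ?_, fun a x g y => ?_,
    fun n hn a x g y => ?_⟩
  · have := hd (wordDeg_word (fun l => (⟨a l, x l⟩ : Σ i, C.X (i + 1))) k) (G.inclT_mem_homog g y)
    rw [hword] at this
    rcases Nat.eq_zero_or_pos (∑ l ∈ Finset.range k, a l + 2 * k + g) with h | h
    · rw [eq_zero_of_mem_homog ?_ this]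
      · exact ⟨0, map_zero _⟩
      · obtain rfl : k = 0 := by omega
        obtain rfl : g = 0 := by omega
        simp
    · have e : ∑ l ∈ Finset.range k, ((a l : ℤ) + 2) + g - 1
          = (∑ l ∈ Finset.range k, a l + 2 * k + g - 1 : ℕ) := by
        rw [Nat.cast_sub h, Finset.sum_add_distrib]
        simp [mul_comm]
      simp only [e] at this
      exact ⟨_, (eq_lof_of_mem_homog this).symm⟩
  · rw [h0', Cx.dT_succ]
  · rw [h0', Cx.dT_zero]
  · have := hR (fun l => ⟨a l, x l⟩) 1 g y
    rw [show C.word (fun l => ⟨a l, x l⟩) 1 = [C.incl (a 0) (x 0)] from rfl] at this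
    simp only [defect, bar, splitSum, ofLetter, zero_add, List.map_nil, List.map_cons,
      AAlgStr.op_singleton, h0, Cx.sgn_incl, h1, Cx.curv_incl, LinearMap.sub_apply,
      LinearMap.add_apply, Module.End.mul_apply, LinearMap.smul_apply, Module.End.one_apply] at this
    have e := map_zsmul (((wordLinear_listFn mG).head []).mk' _) ((-1 : ℤ) ^ (a 0))
      (C.incl (a 0) (x 0))
    simp only [IsLinearMap.mk'_apply, h1] at e
    rw [e, sub_eq_zero] at this
    rw [← this, h0', LinearMap.smul_apply, add_assoc]
    exact add_left_comm _ _ _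
  · obtain ⟨N, rfl⟩ := Nat.exists_eq_add_of_le' (show 1 ≤ n by omega)
    have := hR (fun l => ⟨a l, x l⟩) N g y
    have hl : ofLetter (C.curv e0) (C.word (fun l => ⟨a l, x l⟩) N) = 0 :=
      ofLetter_of_two_le_length _ (by rw [Cx.length_word]; omega)
    rw [defect, hl, zero_smul, sub_zero, LinearMap.add_apply, bar_listFn_word, splitSum_apply,
      splitSum_eq_sum, Cx.length_word] at this
    rw [Finset.sum_add_distrib, ← this]
    congr 1
    · rw [Finset.sum_Icc_succ_top (by omega)]
      simp only [Nat.sub_self, Finset.range_zero, Finset.sum_empty, add_zero, LinearMap.sum_apply]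
      refine Finset.sum_congr rfl fun i hi => ?_
      rw [Finset.mem_Icc] at hi
      rw [show N + 1 - i = N - i + 1 by omega]
      rfl
    · refine Finset.sum_nbij' (fun i => N + 1 - i) (fun t => N + 1 - t) ?_ ?_ ?_ ?_ fun i hi => ?_
      · intro i hi
        simp only [Finset.mem_Icc, Finset.mem_range] at hi ⊢
        omega
      · intro i hi
        simp only [Finset.mem_Icc, Finset.mem_range] at hi ⊢
        omega
      · intro i hi
        simp only [Finset.mem_Icc] at hi
        omega
      · intro i hi
        simp only [Finset.mem_range] at hi
        omega
      rw [Finset.mem_Icc] at hi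
      have e := map_sgn_word_append (wordLinear_listFn mG) (fun l => ⟨a l, x l⟩) (N + 1 - i) []
      simp only [List.append_nil] at e
      have e' : (C.word (fun l => ⟨a l, x l⟩) N).drop (N + 1 - i)
          = List.ofFn fun l : Fin (i - 1) =>
            C.incl (a (N + 1 - i + l)) (x (N + 1 - i + l)) :=
        List.ext_getElem (by simp; omega) fun l h₁ h₂ => by simp [Cx.getElem_word]
      rw [C.take_word _ (by omega), e, hword, listFn_eq mG _ e']
      rfl

end Translation

end Golod

namespace Golod

/-- If `A` is a `Q`-projective resolution of `R = Q/I` with `A_0 = Q`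
equipped with an A∞-algebra structure and `G` is a `Q`-projective resolution of an
`R`-module `M`, then `G` carries an A∞ `A`-module structure. -/
theorem exists_aInfMod (Q : Type) [CommRing Q] (I : Ideal Q)
    (M : Type) [AddCommGroup M] [Module (Q ⧸ I) M] [Module Q M]
    [IsScalarTower Q (Q ⧸ I) M]
    (C : Cx Q) (e0 : C.X 0 ≃ₗ[Q] Q) (ε : C.X 0 →ₗ[Q] Q ⧸ I)
    (hcompat : ∀ x, ε x = Ideal.Quotient.mk I (e0 x))
    (hres : C.IsProjRes (Q ⧸ I) ε)
    (m : AAlgStr C) (hm : IsAInfAlg C e0 m)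
    (G : Cx Q) (εG : G.X 0 →ₗ[Q] M) (hG : G.IsProjRes M εG) :
    ∃ mG : AModStr C G, IsAInfMod C e0 m G mG := by
  have hM : ∀ (x : C.plus) (t : M), C.curv e0 x • t = 0 := by
    intro x t
    have : Ideal.Quotient.mk I (C.curv e0 x) = 0 := by
      refine C.plus_ext (f := (Ideal.Quotient.mkₐ Q I).toLinearMap ∘ₗ C.curv e0) (g := 0)
        (fun i x => ?_) x
      rw [LinearMap.comp_apply, Cx.curv_incl, LinearMap.zero_apply]
      cases i with
      | zero =>
        refine (hcompat (C.d 0 x)).symm.trans ?_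
        rw [← LinearMap.mem_ker, ← hres.1.2.2.1]
        exact LinearMap.mem_range_self _ _
      | succ i => exact map_zero _
    rw [← one_smul (Q ⧸ I) t, ← smul_assoc, Algebra.smul_def, mul_one]
    exact (congrArg (· • t) this).trans (zero_smul _ t)
  obtain ⟨μ, hμ⟩ := exists_forall_isPartialAction hres.1.1 hres.2 hG hM hm
  have hlin := (hμ 0).wordLinear
  have e : listFn hlin.toMultilinear = μ := funext fun w => congrArg μ (List.ofFn_get w)
  refine ⟨hlin.toMultilinear, isAInfMod_of_listFn ?_ ?_ fun s k g y => ?_⟩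
  · rw [e, (hμ 0).map_nil]
  · rw [e]
    exact (hμ 0).isDegNegOne
  · rw [e]
    have hdeg := wordDeg_word s k
    generalize ∑ l ∈ Finset.range k, ((s l).1 + 2 : ℤ) = z at hdeg
    exact (hμ ((z + g).toNat + 1)).vanishesBelow_defect hdeg (G.inclT_mem_homog g y) (by omega)

end Golod
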